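/- arXiv:2512.09875 — 15 statements merged into one kernel-verified Lean document; each statement's English description precedes it below -/
import Mathlib

section
/- (Sholander's Theorem) Let M be a set and I : M × M → 𝒫(M) a map satisfying: (1) I(a,a) = {a} for all a; (2) if c,d ∈ I(a,b) then I(c,d) ⊆ I(a,b); (3) for all a,b,c ∈ M the intersection I(a,b) ∩ I(b,c) ∩ I(a,c) contains exactly one element. Then the ternary operation sending (a,b,c) to the unique element of I(a,b) ∩ I(b,c) ∩ I(a,c) satisfies the median algebra axioms: majority (aab = a), symmetry (abc = bac = acb), and distributivity (ab(cde) = (abc)(abd)e). -/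
/-- Sholander's theorem: a set with an interval map satisfying the three
Sholander axioms, together with the ternary operation sending `(a,b,c)` to the
unique point of `I(a,b) ∩ I(b,c) ∩ I(a,c)`, is a median algebra. -/
theorem sholander {M : Type*} (I : M → M → Set M)
    (h1 : ∀ a : M, I a a = {a})
    (h2 : ∀ a b c d : M, c ∈ I a b → d ∈ I a b → I c d ⊆ I a b)
    (h3 : ∀ a b c : M, ∃! x : M, x ∈ I a b ∧ x ∈ I b c ∧ x ∈ I a c)
    (m : M → M → M → M)
    (hm : ∀ a b c : M, m a b c ∈ I a b ∧ m a b c ∈ I b c ∧ m a b c ∈ I a c) :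
    (∀ a b : M, m a a b = a) ∧
    (∀ a b c : M, m a b c = m b a c) ∧
    (∀ a b c : M, m a b c = m a c b) ∧
    (∀ a b c d e : M, m a b (m c d e) = m (m a b c) (m a b d) e) := by
  have uniq : ∀ a b c x : M, x ∈ I a b → x ∈ I b c → x ∈ I a c → x = m a b c :=
    fun a b c x hab hbc hac => (h3 a b c).unique ⟨hab, hbc, hac⟩ (hm a b c)
  have left_mem : ∀ a b, a ∈ I a b := by
    intro a b
    have h := hm a a b
    have e : m a a b = a := by simpa [h1] using h.1
    rw [e] at h
    exact h.2.1
  have right_mem : ∀ a b, b ∈ I a b := by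
    intro a b
    have h := hm a b b
    have e : m a b b = b := by simpa [h1] using h.2.1
    rw [e] at h
    exact h.1
  have symm : ∀ {a b x}, x ∈ I a b → x ∈ I b a := fun {a b _} hx =>
    h2 b a a b (right_mem b a) (left_mem b a) hx
  have swap_left : ∀ a b c, m a b c = m b a c := fun a b c =>
    uniq _ _ _ _ (symm (hm a b c).1) (hm a b c).2.2 (hm a b c).2.1
  have swap_right : ∀ a b c, m a b c = m a c b := fun a b c =>
    uniq _ _ _ _ (hm a b c).2.2 (symm (hm a b c).2.1) (hm a b c).1
  have sub_left : ∀ {a b x y}, x ∈ I a b → y ∈ I a x → y ∈ I a b := fun {a b x _} hx hy =>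
    h2 a b a x (left_mem a b) hx hy
  have sub_right : ∀ {a b x y}, x ∈ I a b → y ∈ I x b → y ∈ I a b := fun {a b x _} hx hy =>
    h2 a b x b hx (right_mem a b) hy
  have eq_of_mem : ∀ {a b x y}, x ∈ I a b → y ∈ I a x → y ∈ I x b → y = x :=
    fun {a b x y} hx hax hxb =>
      (uniq a x b y hax hxb (sub_left hx hax)).trans
        (uniq a x b x (right_mem a x) (left_mem x b) hx).symm
  have antisymm : ∀ {a x y}, x ∈ I a y → y ∈ I a x → x = y := fun {_ x y} hx hy =>
    eq_of_mem hy hx (right_mem y x)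
  -- `m a x y` is the meet of `x` and `y` for the order `u ≤ v ↔ u ∈ I a v`.
  have le_meet : ∀ {a x y z}, z ∈ I a x → z ∈ I a y → z ∈ I a (m a x y) := by
    intro a x y z hx hy
    have e : m z x y = m a x y := uniq _ _ _ _ (sub_right hx (hm z x y).1) (hm z x y).2.1
      (sub_right hy (hm z x y).2.2)
    have hmz : m a x y ∈ I z x := e ▸ (hm z x y).1
    have hw := hm a z (m a x y)
    have e' : m a z (m a x y) = z := eq_of_mem hx hw.1 (sub_left hmz hw.2.1)
    rw [← e']
    exact (e'.symm ▸ hw.2.2)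
  -- `m a b x` is the gate of `x` in `I a b`.
  have gate : ∀ {a b x z}, z ∈ I a b → m a b x ∈ I x z := by
    intro a b x z hz
    have hq := hm x z a
    have hr := hm x z b
    have hs := hm x (m x z a) (m x z b)
    have hqab : m x z a ∈ I a b := sub_left hz (symm hq.2.1)
    have hrab : m x z b ∈ I a b := sub_right hz hr.2.1
    have e : m x (m x z a) (m x z b) = m a b x :=
      uniq _ _ _ _ (h2 a b _ _ hqab hrab hs.2.1) (symm (sub_left hr.2.2 hs.2.2))
        (symm (sub_left hq.2.2 hs.1))
    exact e ▸ sub_left hq.1 hs.1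
  have proj_mem : ∀ {a b x}, m a b x ∈ I a b := fun {a b x} => (hm a b x).1
  have proj_interval : ∀ {a b c d x}, x ∈ I c d → m a b x ∈ I (m a b c) (m a b d) := by
    intro a b c d x hx
    have hy := hm (m a b c) (m a b d) (m a b x)
    have hyab : m (m a b c) (m a b d) (m a b x) ∈ I a b := h2 a b _ _ proj_mem proj_mem hy.1
    have hyc : m (m a b c) (m a b d) (m a b x) ∈ I (m a b x) c :=
      sub_left (symm (gate proj_mem)) (symm hy.2.2)
    have hyd : m (m a b c) (m a b d) (m a b x) ∈ I (m a b x) d :=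
      sub_left (symm (gate proj_mem)) (symm hy.2.1)
    have hmeet := le_meet hyc hyd
    rw [swap_left (m a b x) c d, swap_right c (m a b x) d] at hmeet
    have hyx : m (m a b c) (m a b d) (m a b x) ∈ I (m a b x) x := sub_left (gate hx) hmeet
    have e : m (m a b c) (m a b d) (m a b x) = m a b x :=
      antisymm (symm hyx) (gate hyab)
    exact e ▸ hy.1
  refine ⟨fun a b => by simpa [h1] using (hm a a b).1, swap_left, swap_right, ?_⟩
  intro a b c d e
  have h := hm c d e
  exact uniq _ _ _ _ (proj_interval h.1)
    (symm (sub_right (gate proj_mem) (symm (proj_interval h.2.1))))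
    (symm (sub_right (gate proj_mem) (symm (proj_interval h.2.2))))
end

section
/- Let M be a median algebra and let [a,b] and [c,d] be two intervals with [a,b] ∩ [c,d] nonempty. Set ĉ = abc and d̂ = abd. Then [a,b] ∩ [c,d] = [ĉ, d̂]. In particular, the intersection of two intervals in a median algebra is either empty or an interval. -/
/-- The median interval `[a,b] = {x | abx = x}`. -/
def medInterval {M : Type*} (m : M → M → M → M) (a b : M) : Set M :=
  {x | m a b x = x}

/-- If `[a,b] ∩ [c,d] ≠ ∅` then, setting `ĉ = abc` and `d̂ = abd`, we have
`[a,b] ∩ [c,d] = [ĉ,d̂]`; so the intersection of two intervals is empty or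
an interval. -/
theorem interval_intersection {M : Type*} (m : M → M → M → M)
    (maj : ∀ a b : M, m a a b = a)
    (symm1 : ∀ a b c : M, m a b c = m b a c)
    (symm2 : ∀ a b c : M, m a b c = m a c b)
    (distrib : ∀ a b c d e : M, m a b (m c d e) = m (m a b c) (m a b d) e)
    (a b c d : M) (hne : (medInterval m a b ∩ medInterval m c d).Nonempty) :
    medInterval m a b ∩ medInterval m c d =
      medInterval m (m a b c) (m a b d) := by
  have maj_last : ∀ u v : M, m u v v = v := fun u v => by
    rw [symm1, symm2, maj]
  have maj_outer : ∀ u v : M, m u v u = u := fun u v => by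
    rw [symm2, maj]
  obtain ⟨p, hpab, hpcd⟩ := hne
  simp only [medInterval, Set.mem_ofPred_eq] at hpab hpcd
  have gate : ∀ z : M, m (m a b z) z p = m a b z := fun z => by
    have h := distrib a b p z z
    rw [maj_last, hpab] at h
    rw [symm2, symm1, ← h]
  have gate_mem : ∀ z : M, m c d z = z → m c d (m a b z) = m a b z := fun z hz => by
    have h := distrib c d z p (m a b z)
    have hg : m z p (m a b z) = m a b z := by
      rw [symm2, symm1, gate]
    rwa [hz, hpcd, hg] at h
  ext x
  simp only [medInterval, Set.mem_inter_iff, Set.mem_ofPred_eq]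
  constructor
  · rintro ⟨hab, hcd⟩
    rw [← distrib, hcd, hab]
  · intro hx
    constructor
    · have hproj : m a b (m c d x) = x := by rw [distrib, hx]
      have h := distrib a b a b (m c d x)
      rwa [maj_outer, maj_last, hproj] at h
    · have h := distrib c d (m a b c) (m a b d) x
      rwa [gate_mem c (maj_outer c d), gate_mem d (maj_last c d), hx] at h
end

section
/- Let M be a median algebra and let (a₁,a₂,a₃,a₄) be a possibly degenerate median square, i.e. a₄a₁a₂ = a₁, a₁a₂a₃ = a₂, a₂a₃a₄ = a₃, a₃a₄a₁ = a₄. Then: (i) if a₁ = a₂ and not all four points are equal, then a₃ = a₄; (ii) if two diagonally opposite points are equal (a₁ = a₃ or a₂ = a₄), then all four points are equal. Consequently, if at least three of the four points are pairwise distinct, then all four are pairwise distinct. -/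
/-- Degenerations of a (possibly degenerate) median square: (i) if two adjacent
vertices coincide (and not all four are equal) then the other two coincide;
(ii) if two diagonally opposite vertices coincide then all four are equal;
consequently if at least three of the points are pairwise distinct then all
four are pairwise distinct. -/
theorem degenerate_median_square {M : Type*} (m : M → M → M → M)
    (maj : ∀ a b : M, m a a b = a)
    (symm1 : ∀ a b c : M, m a b c = m b a c)
    (symm2 : ∀ a b c : M, m a b c = m a c b)
    (distrib : ∀ a b c d e : M, m a b (m c d e) = m (m a b c) (m a b d) e)
    (a1 a2 a3 a4 : M)
    (h1 : m a4 a1 a2 = a1) (h2 : m a1 a2 a3 = a2)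
    (h3 : m a2 a3 a4 = a3) (h4 : m a3 a4 a1 = a4) :
    ((a1 = a2 ∧ ¬(a1 = a2 ∧ a2 = a3 ∧ a3 = a4)) → a3 = a4) ∧
    ((a1 = a3 ∨ a2 = a4) → (a1 = a2 ∧ a2 = a3 ∧ a3 = a4)) ∧
    (3 ≤ ({a1, a2, a3, a4} : Set M).ncard → ({a1, a2, a3, a4} : Set M).ncard = 4) := by
  have adj12 : a1 = a2 → a3 = a4 := fun h => by grind
  have adj34 : a3 = a4 → a1 = a2 := fun h => by grind
  have adj23 : a2 = a3 → a1 = a4 := fun h => by grind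
  have adj41 : a1 = a4 → a2 = a3 := fun h => by grind
  have diag13 : a1 = a3 → a1 = a2 ∧ a1 = a4 := fun h => by grind
  have diag24 : a2 = a4 → a2 = a1 ∧ a2 = a3 := fun h => by grind
  refine ⟨fun h => adj12 h.1, by grind, fun hcard => ?_⟩
  have not_subset_pair (x y : M) : ¬ ({a1, a2, a3, a4} : Set M) ⊆ {x, y} := fun hsub => by
    have := Set.ncard_le_ncard hsub
    have := Set.ncard_insert_le x {y}
    have := Set.ncard_singleton y
    omega
  have h13 : a1 ≠ a3 := fun h => not_subset_pair a1 a1 (by grind)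
  have h24 : a2 ≠ a4 := fun h => not_subset_pair a2 a2 (by grind)
  have h12 : a1 ≠ a2 := fun h => not_subset_pair a1 a3 (by grind)
  have h14 : a1 ≠ a4 := fun h => not_subset_pair a1 a2 (by grind)
  have h23 : a2 ≠ a3 := fun h => h14 (adj23 h)
  have h34 : a3 ≠ a4 := fun h => h12 (adj34 h)
  rw [Set.ncard_insert_of_notMem (by simp [*]), Set.ncard_insert_of_notMem (by simp [*]),
    Set.ncard_pair h34]
end

section
/- Let M be a median algebra and let (a,b,c,d) be a median square (four pairwise distinct points with dab = a, abc = b, bcd = c, cda = d). Then the maps φ : [a,b] × [a,d] → [a,c] given by φ(y,z) = yzc, and ψ : [a,c] → [a,b] × [a,d] given by ψ(x) = (abx, adx), are well-defined and mutually inverse bijections; moreover they are median isomorphisms when [a,b] × [a,d] carries the coordinatewise median operation. -/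
/-- The retraction onto the interval between `a` and `b` preserves the median. -/
theorem median_retraction_map {M : Type*} (m : M → M → M → M)
    (maj : ∀ a b : M, m a a b = a)
    (symm1 : ∀ a b c : M, m a b c = m b a c)
    (symm2 : ∀ a b c : M, m a b c = m a c b)
    (distrib : ∀ a b c d e : M, m a b (m c d e) = m (m a b c) (m a b d) e)
    (a b x y z : M) :
    m a b (m x y z) = m (m a b x) (m a b y) (m a b z) := by
  have idem : ∀ w, m a b (m a b w) = m a b w := fun w => by
    rw [distrib, symm2 a b a, maj, symm1 a b b, symm2 b a b, maj]
  calc m a b (m x y z) = m a b (m (m a b x) (m a b y) z) := by rw [← distrib, idem]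
    _ = m a b (m z (m a b x) (m a b y)) := by rw [symm2 (m a b x), symm1 (m a b x)]
    _ = m (m a b z) (m a b x) (m a b y) := by rw [distrib, idem]
    _ = m (m a b x) (m a b y) (m a b z) := by rw [symm1, symm2]

/-- An interval with an endpoint in common is contained in the larger one. -/
theorem median_interval_trans {M : Type*} (m : M → M → M → M)
    (maj : ∀ a b : M, m a a b = a)
    (symm2 : ∀ a b c : M, m a b c = m a c b)
    (distrib : ∀ a b c d e : M, m a b (m c d e) = m (m a b c) (m a b d) e)
    {a b c y : M} (hb : m a c b = b) (hy : m a b y = y) : m a c y = y := by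
  rw [← hy, distrib, symm2 a c a, maj, hb]

/-- If `a` lies between `b` and `d`, the interval `[a, d]` is collapsed to `a` by the
retraction onto `[a, b]`. -/
theorem median_retraction_eq_left {M : Type*} (m : M → M → M → M)
    (maj : ∀ a b : M, m a a b = a)
    (symm2 : ∀ a b c : M, m a b c = m a c b)
    (distrib : ∀ a b c d e : M, m a b (m c d e) = m (m a b c) (m a b d) e)
    {a b d z : M} (hd : m a b d = a) (hz : m a d z = z) : m a b z = a := by
  rw [← hz, distrib, symm2 a b a, maj, hd, maj]

/-- For a median square `(a,b,c,d)`, the maps `φ(y,z) = yzc` and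
`ψ(x) = (abx, adx)` are well-defined mutually inverse bijections between
`[a,b] × [a,d]` and `[a,c]`, and `φ` preserves the (coordinatewise) median. -/
theorem square_product_structure {M : Type*} (m : M → M → M → M)
    (maj : ∀ a b : M, m a a b = a)
    (symm1 : ∀ a b c : M, m a b c = m b a c)
    (symm2 : ∀ a b c : M, m a b c = m a c b)
    (distrib : ∀ a b c d e : M, m a b (m c d e) = m (m a b c) (m a b d) e)
    (a b c d : M)
    (hab : a ≠ b) (hac : a ≠ c) (had : a ≠ d) (hbc : b ≠ c) (hbd : b ≠ d) (hcd : c ≠ d)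
    (s1 : m d a b = a) (s2 : m a b c = b) (s3 : m b c d = c) (s4 : m c d a = d) :
    -- φ is well-defined
    (∀ y ∈ medInterval m a b, ∀ z ∈ medInterval m a d,
      m y z c ∈ medInterval m a c) ∧
    -- ψ is well-defined
    (∀ x ∈ medInterval m a c,
      m a b x ∈ medInterval m a b ∧ m a d x ∈ medInterval m a d) ∧
    -- φ ∘ ψ = id
    (∀ x ∈ medInterval m a c, m (m a b x) (m a d x) c = x) ∧
    -- ψ ∘ φ = id
    (∀ y ∈ medInterval m a b, ∀ z ∈ medInterval m a d,
      m a b (m y z c) = y ∧ m a d (m y z c) = z) ∧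
    -- φ is a median homomorphism for the coordinatewise median on [a,b] × [a,d]
    (∀ y₁ ∈ medInterval m a b, ∀ y₂ ∈ medInterval m a b, ∀ y₃ ∈ medInterval m a b,
      ∀ z₁ ∈ medInterval m a d, ∀ z₂ ∈ medInterval m a d, ∀ z₃ ∈ medInterval m a d,
      m (m y₁ y₂ y₃) (m z₁ z₂ z₃) c = m (m y₁ z₁ c) (m y₂ z₂ c) (m y₃ z₃ c)) := by
  have retr := median_retraction_map m maj symm1 symm2 distrib
  have idem : ∀ p q w, m p q (m p q w) = m p q w := fun p q w => by
    rw [distrib, symm2 p q p, maj, symm1 p q q, symm2 q p q, maj]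
  have hb : m a c b = b := by rw [symm2, s2]
  have hd : m a c d = d := by rw [symm1, symm2, s4]
  have habd : m a b d = a := by rw [symm2, symm1, s1]
  have hadb : m a d b = a := by rw [symm1, s1]
  have hbdc : m b d c = c := by rw [symm2, s3]
  have hy : ∀ y, m a b y = y → m a c y = y := fun y h =>
    median_interval_trans m maj symm2 distrib hb h
  have hz : ∀ z, m a d z = z → m a c z = z := fun z h =>
    median_interval_trans m maj symm2 distrib hd h
  have phi_mem : ∀ y, m a b y = y → ∀ z, m a d z = z → m a c (m y z c) = m y z c := by
    intro y h z h'
    rw [distrib, hy y h, hz z h']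
  have phi_psi : ∀ x, m a c x = x → m (m a b x) (m a d x) c = x := by
    intro x h
    rw [symm2 a b x, symm1 a x b, symm2 a d x, symm1 a x d, ← distrib, hbdc, symm1, symm2, h]
  have psi_phi_left : ∀ y, m a b y = y → ∀ z, m a d z = z → m a b (m y z c) = y := by
    intro y h z h'
    rw [distrib, h, median_retraction_eq_left m maj symm2 distrib habd h', symm1, symm2,
      hy y h]
  have psi_phi_right : ∀ y, m a b y = y → ∀ z, m a d z = z → m a d (m y z c) = z := by
    intro y h z h'
    rw [distrib, h', median_retraction_eq_left m maj symm2 distrib hadb h, symm2, hz z h']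
  refine ⟨phi_mem, fun x _ => ⟨idem a b x, idem a d x⟩, phi_psi,
    fun y h z h' => ⟨psi_phi_left y h z h', psi_phi_right y h z h'⟩, ?_⟩
  intro y₁ hy₁ y₂ hy₂ y₃ hy₃ z₁ hz₁ z₂ hz₂ z₃ hz₃
  have key := phi_psi (m (m y₁ z₁ c) (m y₂ z₂ c) (m y₃ z₃ c)) (by
    rw [retr, phi_mem y₁ hy₁ z₁ hz₁, phi_mem y₂ hy₂ z₂ hz₂, phi_mem y₃ hy₃ z₃ hz₃])
  rwa [retr a b, retr a d, psi_phi_left y₁ hy₁ z₁ hz₁, psi_phi_left y₂ hy₂ z₂ hz₂,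
    psi_phi_left y₃ hy₃ z₃ hz₃, psi_phi_right y₁ hy₁ z₁ hz₁, psi_phi_right y₂ hy₂ z₂ hz₂,
    psi_phi_right y₃ hy₃ z₃ hz₃] at key
end

section
/- Let M be a median algebra and f : {0,1}ⁿ → M an injective median-preserving map (a median n-cube). Let a = f(0,…,0), b = f(1,…,1), and aᵢ = f(eᵢ) where eᵢ has 1 in the i-th coordinate and 0 elsewhere. Then there is a median isomorphism (a bijection preserving the median operation) between the product ∏ᵢ [a,aᵢ] with coordinatewise median and the interval [a,b]. -/
/-- The majority-vote median on `Bool`. -/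
def bmed (x y z : Bool) : Bool := (x && y) || (y && z) || (x && z)

/-- The axioms of a median algebra. -/
structure IsMedian {M : Type*} (m : M → M → M → M) : Prop where
  maj : ∀ a b : M, m a a b = a
  symm1 : ∀ a b c : M, m a b c = m b a c
  symm2 : ∀ a b c : M, m a b c = m a c b
  distrib : ∀ a b c d e : M, m a b (m c d e) = m (m a b c) (m a b d) e

namespace IsMedian

variable {M : Type*} {m : M → M → M → M} {a b c x y z : M}

theorem rotate (hm : IsMedian m) (x y z : M) : m x y z = m y z x := by
  rw [hm.symm1, hm.symm2]

theorem maj_outer (hm : IsMedian m) (x y : M) : m x y x = x := by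
  rw [hm.symm2, hm.maj]

theorem maj_right (hm : IsMedian m) (x y : M) : m x y y = y := by
  rw [hm.rotate, hm.maj]

theorem assoc (hm : IsMedian m) (a x y z : M) : m a x (m a y z) = m a (m a x y) z := by
  rw [hm.distrib, hm.maj_outer]

theorem proj_idem (hm : IsMedian m) (a b x : M) : m a b (m a b x) = m a b x := by
  rw [hm.assoc, hm.maj_right]

/-- The projection to an interval preserves the median. -/
theorem proj_median (hm : IsMedian m) (a b x y z : M) :
    m a b (m x y z) = m (m a b x) (m a b y) (m a b z) := by
  rw [← hm.proj_idem a b (m x y z), hm.distrib a b x y z, ← hm.rotate z, hm.distrib,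
    hm.proj_idem, hm.rotate]

theorem median_mem_medInterval (hm : IsMedian m) (hx : x ∈ medInterval m a b)
    (hy : y ∈ medInterval m a b) (hz : z ∈ medInterval m a b) :
    m x y z ∈ medInterval m a b := by
  change m a b _ = _
  rw [hm.proj_median, hx, hy, hz]

theorem left_mem_medInterval (hm : IsMedian m) (a b : M) : a ∈ medInterval m a b :=
  hm.maj_outer a b

theorem right_mem_medInterval (hm : IsMedian m) (a b : M) : b ∈ medInterval m a b :=
  hm.maj_right a b

theorem medInterval_subset (hm : IsMedian m) (hc : c ∈ medInterval m a b) :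
    medInterval m a c ⊆ medInterval m a b := by
  intro x hx
  change m a b x = x
  rw [← show m a c x = x from hx, hm.assoc, hc]

theorem inf_sup_self (hm : IsMedian m) (hx : x ∈ medInterval m a b) (y : M) :
    m a x (m b x y) = x := by
  rw [hm.symm1 a x, hm.symm1 b x, hm.distrib, hm.maj_outer, hm.rotate x a b,
    show m a b x = x from hx, hm.maj]

theorem mem_medInterval_comm (hm : IsMedian m) (hx : x ∈ medInterval m a b) :
    x ∈ medInterval m b a := by
  change m b a x = x
  rw [hm.symm1]
  exact hx

/-- The interval `[a,b]` is a distributive lattice with meet `m a` and join `m b`. -/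
abbrev intervalLattice (hm : IsMedian m) (a b : M) : DistribLattice (medInterval m a b) :=
  letI : Max (medInterval m a b) :=
    ⟨fun x y => ⟨m b x y, hm.median_mem_medInterval (hm.right_mem_medInterval a b) x.2 y.2⟩⟩
  letI : Min (medInterval m a b) :=
    ⟨fun x y => ⟨m a x y, hm.median_mem_medInterval (hm.left_mem_medInterval a b) x.2 y.2⟩⟩
  letI : Lattice (medInterval m a b) := Lattice.mk'
    (fun x y => Subtype.ext (hm.symm2 b x y))
    (fun x y z => Subtype.ext (hm.assoc b x y z).symm)
    (fun x y => Subtype.ext (hm.symm2 a x y))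
    (fun x y z => Subtype.ext (hm.assoc a x y z).symm)
    (fun x y => Subtype.ext (hm.inf_sup_self (hm.mem_medInterval_comm x.2) y))
    (fun x y => Subtype.ext (hm.inf_sup_self x.2 y))
  DistribLattice.ofInfSupLe fun x y z => le_of_eq <| Subtype.ext <| by
    change m a x (m b y z) = m b (m a x y) (m a x z)
    rw [hm.rotate b y z, hm.distrib, ← hm.rotate b]

end IsMedian

section DistribLattice

variable {α ι : Type*} [DistribLattice α] [OrderBot α] [Fintype ι] {e : ι → α}

theorem sup_inf_eq_of_pairwise_disjoint (he : ∀ i j, i ≠ j → e i ⊓ e j = ⊥) {g : ι → α}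
    (hg : ∀ i, g i ≤ e i) (j : ι) : e j ⊓ Finset.univ.sup g = g j := by
  rw [Finset.sup_inf_distrib_left]
  refine le_antisymm (Finset.sup_le fun i _ => ?_) ?_
  · by_cases hij : j = i
    · subst hij
      exact inf_le_right
    · exact (inf_le_inf_left _ (hg i)).trans ((he j i hij).le.trans bot_le)
  · exact (le_inf (hg j) le_rfl).trans
      (Finset.le_sup (f := fun i => e j ⊓ g i) (Finset.mem_univ j))

theorem sup_inf_eq_self (he : ∀ x, x ≤ Finset.univ.sup e) (x : α) :
    Finset.univ.sup (fun i => e i ⊓ x) = x := by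
  rw [← Finset.sup_inf_distrib_right]
  exact inf_eq_right.2 (he x)

end DistribLattice

theorem IsMedian.exists_bijOn_medInterval {M : Type*} {m : M → M → M → M} (hm : IsMedian m)
    {n : ℕ} {f : (Fin n → Bool) → M}
    (hmed : ∀ u v w : Fin n → Bool,
      f (fun i => bmed (u i) (v i) (w i)) = m (f u) (f v) (f w)) :
    ∃ Φ : (Fin n → M) → M,
      Set.BijOn Φ
        {g : Fin n → M | ∀ i : Fin n,
          g i ∈ medInterval m (f fun _ => false) (f fun j => decide (j = i))}
        (medInterval m (f fun _ => false) (f fun _ => true)) ∧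
      ∀ g h k : Fin n → M,
        (∀ i : Fin n,
          g i ∈ medInterval m (f fun _ => false) (f fun j => decide (j = i))) →
        (∀ i : Fin n,
          h i ∈ medInterval m (f fun _ => false) (f fun j => decide (j = i))) →
        (∀ i : Fin n,
          k i ∈ medInterval m (f fun _ => false) (f fun j => decide (j = i))) →
        Φ (fun i => m (g i) (h i) (k i)) = m (Φ g) (Φ h) (Φ k) := by
  set a := f fun _ => false with ha
  set b := f fun _ => true with hb
  have hf (u : Fin n → Bool) : f u ∈ medInterval m a b := by
    change m a b (f u) = f u
    rw [ha, hb, ← hmed]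
    simp [bmed]
  let := hm.intervalLattice a b
  have inf_def (x y : medInterval m a b) : ((x ⊓ y : medInterval m a b) : M) = m a x y := rfl
  have sup_def (x y : medInterval m a b) : ((x ⊔ y : medInterval m a b) : M) = m b x y := rfl
  let : OrderBot (medInterval m a b) :=
    { bot := ⟨a, hm.left_mem_medInterval a b⟩
      bot_le := fun x => inf_eq_left.1 (Subtype.ext (hm.maj a x)) }
  have bot_def : ((⊥ : medInterval m a b) : M) = a := rfl
  let e (i : Fin n) : medInterval m a b := ⟨f fun j => decide (j = i), hf _⟩
  have he_disj (i j : Fin n) (hij : i ≠ j) : e i ⊓ e j = ⊥ := by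
    apply Subtype.ext
    change m (f _) (f _) (f _) = f _
    rw [← hmed]
    congr 1
    funext k
    simp only [bmed]
    grind
  have he_sup (s : Finset (Fin n)) : ((s.sup e : medInterval m a b) : M) =
      f fun j => decide (j ∈ s) := by
    induction s using Finset.induction_on with
    | empty => simp [bot_def, ha]
    | insert i s _ ih =>
      rw [Finset.sup_insert, sup_def, ih]
      change m (f _) (f _) (f _) = f _
      rw [← hmed]
      congr 1
      funext k
      simp only [bmed, Finset.mem_insert]
      grind
  have he_top (x : medInterval m a b) : x ≤ Finset.univ.sup e := by
    refine inf_eq_right.1 (Subtype.ext ?_)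
    rw [inf_def, he_sup]
    simp only [Finset.mem_univ, decide_true]
    exact x.2
  let p (x : M) : medInterval m a b := ⟨m a b x, hm.proj_idem a b x⟩
  have p_coe {x : M} (hx : x ∈ medInterval m a b) : (p x : M) = x := hx
  let Φ (g : Fin n → M) : M := (Finset.univ.sup fun i => p (g i) : medInterval m a b)
  have Φ_mem (g : Fin n → M) : Φ g ∈ medInterval m a b := Subtype.coe_prop _
  have proj_Φ {g : Fin n → M} (hg : ∀ i, g i ∈ medInterval m a (e i)) (j : Fin n) :
      m a (e j) (Φ g) = g j := by
    have hp (i : Fin n) : (p (g i) : M) = g i := p_coe (hm.medInterval_subset (e i).2 (hg i))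
    have h := sup_inf_eq_of_pairwise_disjoint he_disj (g := fun i => p (g i))
      (fun i => inf_eq_right.1 (Subtype.ext (by rw [inf_def, hp]; exact hg i))) j
    rw [← hp j, ← h]
    rfl
  have Φ_proj {x : M} (hx : x ∈ medInterval m a b) : Φ (fun i => m a (e i) x) = x := by
    have h := congrArg Subtype.val (sup_inf_eq_self he_top ⟨x, hx⟩)
    refine Eq.trans ?_ h
    refine congrArg (fun q : Fin n → medInterval m a b => ((Finset.univ.sup q : medInterval m a b) : M)) ?_
    funext i
    exact Subtype.ext (p_coe (e i ⊓ ⟨x, hx⟩ : medInterval m a b).2)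
  refine ⟨Φ, ⟨fun g _ => Φ_mem g, fun g hg h hh hgh => ?_, fun x hx => ?_⟩,
    fun g h k hg hh hk => ?_⟩
  · funext i
    rw [← proj_Φ hg i, ← proj_Φ hh i, hgh]
  · exact ⟨fun i => m a (e i) x, fun i => hm.proj_idem a (e i) x, Φ_proj hx⟩
  · rw [← Φ_proj (hm.median_mem_medInterval (Φ_mem g) (Φ_mem h) (Φ_mem k))]
    congr 1
    funext i
    rw [hm.proj_median, proj_Φ hg, proj_Φ hh, proj_Φ hk]

/-- For a median `n`-cube `f : {0,1}ⁿ → M` with `a = f(0,…,0)`, `b = f(1,…,1)`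
and `aᵢ = f(eᵢ)`, there is a median isomorphism between `∏ᵢ [a,aᵢ]`
(with coordinatewise median) and `[a,b]`. -/
theorem cube_interval_product {M : Type*} (m : M → M → M → M)
    (maj : ∀ a b : M, m a a b = a)
    (symm1 : ∀ a b c : M, m a b c = m b a c)
    (symm2 : ∀ a b c : M, m a b c = m a c b)
    (distrib : ∀ a b c d e : M, m a b (m c d e) = m (m a b c) (m a b d) e)
    (n : ℕ) (f : (Fin n → Bool) → M)
    (hinj : Function.Injective f)
    (hmed : ∀ u v w : Fin n → Bool,
      f (fun i => bmed (u i) (v i) (w i)) = m (f u) (f v) (f w)) :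
    ∃ Φ : (Fin n → M) → M,
      Set.BijOn Φ
        {g : Fin n → M | ∀ i : Fin n,
          g i ∈ medInterval m (f fun _ => false) (f fun j => decide (j = i))}
        (medInterval m (f fun _ => false) (f fun _ => true)) ∧
      ∀ g h k : Fin n → M,
        (∀ i : Fin n,
          g i ∈ medInterval m (f fun _ => false) (f fun j => decide (j = i))) →
        (∀ i : Fin n,
          h i ∈ medInterval m (f fun _ => false) (f fun j => decide (j = i))) →
        (∀ i : Fin n,
          k i ∈ medInterval m (f fun _ => false) (f fun j => decide (j = i))) →
        Φ (fun i => m (g i) (h i) (k i)) = m (Φ g) (Φ h) (Φ k) := by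
  exact IsMedian.exists_bijOn_medInterval ⟨maj, symm1, symm2, distrib⟩ hmed
end

section
/- Let M be a median algebra and suppose (a,b,c,d) and (x,y,c,d) are median squares (pairwise distinct points with the cyclic median relations dab = a, abc = b, bcd = c, cda = d, and dxy = x, xyc = y, ycd = c, cdx = d). Then (a,b,y,x) satisfies the cyclic median relations of a median square: xab = a, aby = b, byx = y, yxa = x. -/
/-- In a median square `(a,b,c,d)`, projecting to `[c,d]` and then to `[a,b]`
is the same as projecting directly to `[a,b]`. -/
theorem median_project_opposite_side {M : Type*} (m : M → M → M → M)
    (symm1 : ∀ a b c : M, m a b c = m b a c)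
    (distrib : ∀ a b c d e : M, m a b (m c d e) = m (m a b c) (m a b d) e)
    {a b c d : M} (hc : m a b c = b) (hd : m a b d = a) (e : M) :
    m a b (m c d e) = m a b e := by
  rw [distrib, hc, hd, symm1]

/-- If `(a,b,c,d)` and `(x,y,c,d)` are median squares then `(a,b,y,x)`
satisfies the cyclic median relations of a median square. -/
theorem rectangles_are_squares {M : Type*} (m : M → M → M → M)
    (maj : ∀ a b : M, m a a b = a)
    (symm1 : ∀ a b c : M, m a b c = m b a c)
    (symm2 : ∀ a b c : M, m a b c = m a c b)
    (distrib : ∀ a b c d e : M, m a b (m c d e) = m (m a b c) (m a b d) e)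
    (a b c d x y : M)
    (hab : a ≠ b) (hac : a ≠ c) (had : a ≠ d) (hbc : b ≠ c) (hbd : b ≠ d) (hcd : c ≠ d)
    (hxy : x ≠ y) (hxc : x ≠ c) (hxd : x ≠ d) (hyc : y ≠ c) (hyd : y ≠ d)
    (s1 : m d a b = a) (s2 : m a b c = b) (s3 : m b c d = c) (s4 : m c d a = d)
    (t1 : m d x y = x) (t2 : m x y c = y) (t3 : m y c d = c) (t4 : m c d x = d) :
    m x a b = a ∧ m a b y = b ∧ m b y x = y ∧ m y x a = x := by
  have rot (p q r : M) : m p q r = m q r p := by rw [symm1, symm2]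
  have hd : m a b d = a := (rot d a b).symm.trans s1
  have hd' : m x y d = x := (rot d x y).symm.trans t1
  have hb : m c d b = c := (rot b c d).symm.trans s3
  have hy : m c d y = c := (rot y c d).symm.trans t3
  have hab' := median_project_opposite_side m symm1 distrib s2 hd
  have hxy' := median_project_opposite_side m symm1 distrib t2 hd'
  refine ⟨?_, ?_, ?_, ?_⟩
  · rw [rot, ← hab', t4, hd]
  · rw [← hab', hy, s2]
  · rw [rot, symm1, ← hxy', hb, t2]
  · rw [symm1, ← hxy', s4, hd']
end

section
/- (Double projection) Let M be a median algebra and a,b,c,d ∈ M distinct elements with abc = b and bcd = c. Let d̂ = cda (the gate projection of a onto [c,d]) and â = abd (the gate projection of d onto [a,b]). Then (â, b, c, d̂) is a possibly degenerate median square: d̂âb = â, âbc = b, bcd̂ = c, and cd̂â = d̂. -/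
/-- Double projection: if `abc = b` and `bcd = c`, then with `d̂ = cda` and
`â = abd`, the quadruple `(â, b, c, d̂)` is a possibly degenerate median
square. -/
theorem double_projection {M : Type*} (m : M → M → M → M)
    (maj : ∀ a b : M, m a a b = a)
    (symm1 : ∀ a b c : M, m a b c = m b a c)
    (symm2 : ∀ a b c : M, m a b c = m a c b)
    (distrib : ∀ a b c d e : M, m a b (m c d e) = m (m a b c) (m a b d) e)
    (a b c d : M)
    (hab : a ≠ b) (hac : a ≠ c) (had : a ≠ d) (hbc : b ≠ c) (hbd : b ≠ d) (hcd : c ≠ d)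
    (h1 : m a b c = b) (h2 : m b c d = c) :
    m (m c d a) (m a b d) b = m a b d ∧
    m (m a b d) b c = b ∧
    m b c (m c d a) = c ∧
    m c (m c d a) (m a b d) = m c d a := by
  have idem : ∀ x y z : M, m x y (m x y z) = m x y z := by
    intro x y z
    rw [distrib, symm2 x y x, symm1 x y y, symm2 y x y, maj, maj]
  have cyc : ∀ x y z : M, m x y z = m y z x := fun x y z => by
    rw [symm1 x y z, symm2 y x z]
  have gate_left : m a b (m c d a) = m a b d := by
    rw [distrib, h1, ← cyc, idem]
  have gate_right : m c d (m a b d) = m c d a := by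
    have h3 : m c d b = c := by rw [← cyc, h2]
    rw [distrib, h3, symm1, symm2 c, idem]
  have gate_left' : m b (m c d a) a = m a b d := by rw [← cyc, gate_left]
  have gate_right' : m c (m a b d) d = m c d a := by rw [symm2, gate_right]
  refine ⟨?_, ?_, ?_, ?_⟩
  · rw [← cyc, ← gate_left', idem]
  · rw [cyc, symm2 a, distrib, h2, ← cyc a, h1, symm2, maj]
  · rw [cyc c, distrib, h2, ← cyc a, h1, symm2, maj]
  · rw [symm2, ← gate_right', idem]
end

section
/- Let M be a median algebra and a,b ∈ M. The half-open interval (a,b] = [a,b] \ {a} is not convex if and only if there exists a median square contained in [a,b] having a as one of its four vertices (i.e., there exist pairwise distinct points a,c,e,d ∈ [a,b] with dac = a, ace = c, ced = e, eda = d). -/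
/-- A subset `C` is convex if for all `a, b ∈ C`, `[a,b] ⊆ C`. -/
def MedConvex {M : Type*} (m : M → M → M → M) (C : Set M) : Prop :=
  ∀ a ∈ C, ∀ b ∈ C, medInterval m a b ⊆ C

/-- The half-open interval `(a,b] = [a,b] \ {a}` fails to be convex exactly
when `[a,b]` contains a median square having `a` as a vertex. -/
theorem half_open_not_convex_iff_square {M : Type*} (m : M → M → M → M)
    (maj : ∀ a b : M, m a a b = a)
    (symm1 : ∀ a b c : M, m a b c = m b a c)
    (symm2 : ∀ a b c : M, m a b c = m a c b)
    (distrib : ∀ a b c d e : M, m a b (m c d e) = m (m a b c) (m a b d) e)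
    (a b : M) :
    ¬ MedConvex m (medInterval m a b \ {a}) ↔
      ∃ c e d : M,
        c ∈ medInterval m a b ∧ e ∈ medInterval m a b ∧ d ∈ medInterval m a b ∧
        a ≠ c ∧ a ≠ e ∧ a ≠ d ∧ c ≠ e ∧ c ≠ d ∧ e ≠ d ∧
        m d a c = a ∧ m a c e = c ∧ m c e d = e ∧ m e d a = d := by
  have last : ∀ x y, m x y y = y := fun x y => by rw [symm1, symm2, maj]
  have rot : ∀ x y z, m x y z = m y z x := fun x y z => by rw [symm1, symm2]
  have join_mem : ∀ x y, m x y (m x y b) = m x y b := fun x y => by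
    rw [distrib, symm2 x y x, maj, last]
  have absorb : ∀ x y, m a x y = a → m a b x = x → m a x (m x y b) = x := fun x y hxy hx => by
    rw [rot x y b, distrib, hxy, symm2 a x b, hx, last]
  constructor
  · intro h
    simp only [MedConvex, not_forall, Set.not_subset] at h
    obtain ⟨c, ⟨hc, hca⟩, d, ⟨hd, hda⟩, x, hx, hx'⟩ := h
    simp only [medInterval, Set.mem_ofPred_eq, Set.mem_singleton_iff] at hc hd hca hda hx
    have hxab : m a b x = x := by
      rw [← hx, distrib, hc, hd]
    obtain rfl : x = a := by
      by_contra hne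
      exact hx' ⟨hxab, hne⟩
    have hcd : m x c d = x := by rw [rot, hx]
    have hdc : m x d c = x := by rw [symm2, hcd]
    have hce := absorb c d hcd hc
    have hde : m x d (m c d b) = d := by
      rw [symm1 c d b]
      exact absorb d c hdc hd
    refine ⟨c, m c d b, d, hc, ?_, hd, Ne.symm hca, ?_, Ne.symm hda, ?_, ?_, ?_, ?_, hce, ?_, ?_⟩
    · change m x b (m c d b) = m c d b
      rw [distrib, hc, hd]
    · intro he
      rw [← he, symm2, maj] at hce
      exact hca hce.symm
    · intro he
      rw [← he, hdc] at hde
      exact hda hde.symm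
    · rintro rfl
      rw [maj] at hx
      exact hca hx
    · intro he
      rw [he, hcd] at hce
      exact hca hce.symm
    · rw [symm1, hdc]
    · rw [symm2, join_mem]
    · rw [← rot, symm2, hde]
  · rintro ⟨c, e, d, hc, -, hd, hac, -, had, -, -, -, hdac, -⟩ h
    have hmem : a ∈ medInterval m c d := by
      change m c d a = a
      rw [rot, hdac]
    exact (h c ⟨hc, hac.symm⟩ d ⟨hd, had.symm⟩ hmem).2 rfl
end

section
/- There is only one topological median algebra structure on the real line: if m : ℝ³ → ℝ is a continuous ternary operation satisfying the median algebra axioms (majority, symmetry, distributivity), then for all a,x,b ∈ ℝ with a ≤ x ≤ b one has m(a,x,b) = x. -/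
/-- The real line has a unique topological median algebra structure: any
continuous median operation on `ℝ` satisfies `m a x b = x` whenever
`a ≤ x ≤ b`. -/
theorem unique_median_structure_on_real (m : ℝ → ℝ → ℝ → ℝ)
    (hcont : Continuous fun p : ℝ × ℝ × ℝ => m p.1 p.2.1 p.2.2)
    (maj : ∀ a b : ℝ, m a a b = a)
    (symm1 : ∀ a b c : ℝ, m a b c = m b a c)
    (symm2 : ∀ a b c : ℝ, m a b c = m a c b)
    (distrib : ∀ a b c d e : ℝ, m a b (m c d e) = m (m a b c) (m a b d) e) :
    ∀ a x b : ℝ, a ≤ x → x ≤ b → m a x b = x := by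
  intro a x b hax hxb
  have left_eq : m a b a = a := by rw [symm2, maj]
  have right_eq : m a b b = b := by rw [symm1, symm2, maj]
  have idem (t : ℝ) : m a b (m a b t) = m a b t := by
    rw [distrib, left_eq, right_eq]
  have cont : Continuous fun t => m a b t :=
    hcont.comp (by fun_prop : Continuous fun t : ℝ => (a, b, t))
  have surj := intermediate_value_Icc (hax.trans hxb) cont.continuousOn
  simp only [left_eq, right_eq] at surj
  obtain ⟨t, -, rfl⟩ := surj ⟨hax, hxb⟩
  rw [symm2, idem]
end

section
/- (Fioravanti) Let M be a path-connected topological space equipped with a continuous ternary operation satisfying the median algebra axioms (majority, symmetry, distributivity). Then for every n ≥ 1 and every basepoint * ∈ M, the homotopy group πₙ(M, *) is trivial. -/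
namespace GenLoop

variable {N M : Type*} [TopologicalSpace M] {m : M → M → M → M}
  {x : M}

/-- The pointwise image of three generalized loops under a continuous ternary operation that
fixes the base point. -/
def map₃ (hm : Continuous fun p : M × M × M => m p.1 p.2.1 p.2.2) (hx : m x x x = x)
    (f g h : GenLoop N M x) : GenLoop N M x :=
  ⟨⟨fun t => m (f t) (g t) (h t),
    hm.comp (f.1.continuous.prodMk (g.1.continuous.prodMk h.1.continuous))⟩,
    fun t ht => by
      change m (f t) (g t) (h t) = x
      rw [boundary f t ht, boundary g t ht, boundary h t ht, hx]⟩

theorem map₃_apply (hm : Continuous fun p : M × M × M => m p.1 p.2.1 p.2.2) (hx : m x x x = x)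
    (f g h : GenLoop N M x) (t : N → unitInterval) :
    map₃ hm hx f g h t = m (f t) (g t) (h t) :=
  rfl

theorem Homotopic.map₃ (hm : Continuous fun p : M × M × M => m p.1 p.2.1 p.2.2)
    (hx : m x x x = x) {f f' g g' h h' : GenLoop N M x} (hf : Homotopic f f')
    (hg : Homotopic g g') (hh : Homotopic h h') :
    Homotopic (map₃ hm hx f g h) (map₃ hm hx f' g' h') := by
  obtain ⟨F⟩ := hf
  obtain ⟨G⟩ := hg
  obtain ⟨H⟩ := hh
  refine ⟨⟨⟨⟨fun p => m (F p) (G p) (H p), ?_⟩, fun t => ?_, fun t => ?_⟩, fun s t ht => ?_⟩⟩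
  · exact hm.comp (F.continuous.prodMk (G.continuous.prodMk H.continuous))
  · change m (F (0, t)) (G (0, t)) (H (0, t)) = _
    rw [F.apply_zero, G.apply_zero, H.apply_zero]
    rfl
  · change m (F (1, t)) (G (1, t)) (H (1, t)) = _
    rw [F.apply_one, G.apply_one, H.apply_one]
    rfl
  · change m (F (s, t)) (G (s, t)) (H (s, t)) = _
    rw [F.eq_fst s ht, G.eq_fst s ht, H.eq_fst s ht]
    rfl

variable [DecidableEq N]

theorem map₃_transAt (hm : Continuous fun p : M × M × M => m p.1 p.2.1 p.2.2)
    (hx : m x x x = x) (i : N) (f f' g g' h h' : GenLoop N M x) :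
    map₃ hm hx (transAt i f f') (transAt i g g') (transAt i h h') =
      transAt i (map₃ hm hx f g h) (map₃ hm hx f' g' h') := by
  ext t
  simp only [map₃_apply, transAt, coe_copy]
  split_ifs <;> rfl

theorem homotopic_transAt_const [Nonempty N] (i : N) (f : GenLoop N M x) :
    Homotopic f (transAt i f const) :=
  Quotient.exact (HomotopyGroup.mul_spec.symm.trans (one_mul (M := HomotopyGroup N M x) ⟦f⟧)).symm

theorem homotopic_const_transAt [Nonempty N] (i : N) (f : GenLoop N M x) :
    Homotopic f (transAt i const f) :=
  Quotient.exact (HomotopyGroup.mul_spec.symm.trans (mul_one (M := HomotopyGroup N M x) ⟦f⟧)).symm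

/-- A continuous symmetric majority operation contracts every generalized loop. -/
theorem homotopic_const_of_majority [Nonempty N]
    (hm : Continuous fun p : M × M × M => m p.1 p.2.1 p.2.2) (maj : ∀ a b : M, m a a b = a)
    (symm1 : ∀ a b c : M, m a b c = m b a c) (symm2 : ∀ a b c : M, m a b c = m a c b)
    (f : GenLoop N M x) : Homotopic f const := by
  have hx : m x x x = x := maj x x
  let i : N := Classical.arbitrary N
  have h₁ : map₃ hm hx f f const = f := by
    ext t
    rw [map₃_apply, maj]
  have h₂ : map₃ hm hx f const const = const := by
    ext t
    simp only [map₃_apply, const_apply]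
    rw [symm1, symm2, maj]
  have h₃ : map₃ hm hx const f const = const := by
    ext t
    simp only [map₃_apply, const_apply]
    rw [symm2, maj]
  have key := Homotopic.map₃ hm hx (homotopic_transAt_const i f) (homotopic_const_transAt i f)
    (homotopic_transAt_const i const)
  rw [map₃_transAt, h₁, h₂, h₃] at key
  exact key.trans (homotopic_transAt_const i const).symm

end GenLoop

/-- (Fioravanti) A path-connected topological median algebra has trivial
homotopy groups `πₙ` for all `n ≥ 1` and all basepoints. -/
theorem median_algebra_trivial_homotopy_groups {M : Type*} [TopologicalSpace M]
    [PathConnectedSpace M] (m : M → M → M → M)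
    (hcont : Continuous fun p : M × M × M => m p.1 p.2.1 p.2.2)
    (maj : ∀ a b : M, m a a b = a)
    (symm1 : ∀ a b c : M, m a b c = m b a c)
    (symm2 : ∀ a b c : M, m a b c = m a c b)
    (distrib : ∀ a b c d e : M, m a b (m c d e) = m (m a b c) (m a b d) e) :
    ∀ n : ℕ, 1 ≤ n → ∀ x : M, Subsingleton (HomotopyGroup (Fin n) M x) := by
  intro n hn x
  have : Nonempty (Fin n) := ⟨⟨0, hn⟩⟩
  refine subsingleton_of_forall_eq ⟦GenLoop.const⟧ fun a => ?_
  induction a using Quotient.inductionOn with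
  | h f => exact Quotient.sound (GenLoop.homotopic_const_of_majority hcont maj symm1 symm2 f)
end

section
/- Let M be a median algebra, a,b ∈ M, and suppose the interval [a,b] is not additive, witnessed by x ∈ [a,b] and y ∈ [a,b] with y ∉ [a,x] ∪ [x,b]. Set u = axy and v = bxy. Then (x,u,y,v) is a median square: the points x,u,y,v are pairwise distinct and satisfy uxv = x, yux = u, uyv = y, yvx = v. In particular a non-additive interval contains a median square, so a rank-1 interval is additive. -/
/-- If `y ∈ [a,b]` and `x ∈ [a,y]`, then `y ∈ [x,b]`. -/
theorem mem_medInterval_of_chain {M : Type*} {m : M → M → M → M}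
    (maj : ∀ a b : M, m a a b = a)
    (symm1 : ∀ a b c : M, m a b c = m b a c)
    (symm2 : ∀ a b c : M, m a b c = m a c b)
    (distrib : ∀ a b c d e : M, m a b (m c d e) = m (m a b c) (m a b d) e)
    {a b x y : M} (hy : m a b y = y) (hx : m a x y = x) : m x b y = y := by
  have h := distrib y b a x y
  have hyba : m y b a = y := by rw [symm1, symm2, symm1, hy]
  rw [hx, hyba, symm2 y _ y, maj] at h
  rw [symm1, symm2, symm1, h]

/-- The median of `x`, `y` and a third point lies in `[y,x]`. -/
theorem med_mem_medInterval {M : Type*} {m : M → M → M → M}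
    (maj : ∀ a b : M, m a a b = a)
    (symm1 : ∀ a b c : M, m a b c = m b a c)
    (symm2 : ∀ a b c : M, m a b c = m a c b)
    (distrib : ∀ a b c d e : M, m a b (m c d e) = m (m a b c) (m a b d) e)
    (a x y : M) : m y (m a x y) x = m a x y := by
  have h := distrib y x x y a
  have h1 : m y x x = x := by rw [symm1, symm2, maj]
  have h2 : m y x y = y := by rw [symm2, maj]
  have h3 : m x y a = m a x y := by rw [symm2, symm1]
  rw [h1, h2, h3] at h
  rw [symm2, h]

/-- A non-additive interval contains a median square: if `x, y ∈ [a,b]` with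
`y ∉ [a,x] ∪ [x,b]`, then with `u = axy` and `v = bxy`, the quadruple
`(x,u,y,v)` is a median square. -/
theorem nonadditive_interval_contains_square {M : Type*} (m : M → M → M → M)
    (maj : ∀ a b : M, m a a b = a)
    (symm1 : ∀ a b c : M, m a b c = m b a c)
    (symm2 : ∀ a b c : M, m a b c = m a c b)
    (distrib : ∀ a b c d e : M, m a b (m c d e) = m (m a b c) (m a b d) e)
    (a b x y : M)
    (hx : x ∈ medInterval m a b) (hy : y ∈ medInterval m a b)
    (hy' : y ∉ medInterval m a x ∪ medInterval m x b) :
    (x ≠ m a x y ∧ x ≠ y ∧ x ≠ m b x y ∧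
     m a x y ≠ y ∧ m a x y ≠ m b x y ∧ y ≠ m b x y) ∧
    (m (m a x y) x (m b x y) = x ∧
     m y (m a x y) x = m a x y ∧
     m (m a x y) y (m b x y) = y ∧
     m y (m b x y) x = m b x y) := by
  have hx : m a b x = x := hx
  have hy : m a b y = y := hy
  have hax : m a x y ≠ y := fun h => hy' (Or.inl h)
  have hxb : m x b y ≠ y := fun h => hy' (Or.inr h)
  have hbx : m b x y ≠ y := by rwa [symm1]
  have hxu : x ≠ m a x y := fun h =>
    hxb (mem_medInterval_of_chain maj symm1 symm2 distrib hy h.symm)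
  have hxv : x ≠ m b x y := fun h => by
    have hy₂ : m b a y = y := by rwa [symm1]
    exact hax (by rw [symm1]; exact mem_medInterval_of_chain maj symm1 symm2 distrib hy₂ h.symm)
  have hu : m x y a = m a x y := by rw [symm2, symm1]
  have hv : m x y b = m b x y := by rw [symm2, symm1]
  have huxv : m (m a x y) x (m b x y) = x := by
    have h := distrib x y a b x
    rw [hx, hu, hv, symm2 x y x, maj] at h
    rw [symm2, ← h]
  have huyv : m (m a x y) y (m b x y) = y := by
    have h := distrib x y a b y
    rw [hy, hu, hv, symm1 x y y, symm2 y x y, maj] at h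
    rw [symm2, ← h]
  refine ⟨⟨hxu, ?_, hxv, hax, ?_, hbx.symm⟩, huxv,
    med_mem_medInterval maj symm1 symm2 distrib a x y, huyv,
    med_mem_medInterval maj symm1 symm2 distrib b x y⟩
  · rintro rfl
    exact hax (by rw [symm1, symm2, maj])
  · intro h
    rw [← h, symm2, maj] at huxv
    exact hxu huxv.symm
end

section
/- Let M be a Hausdorff, path-connected topological median algebra, and let a,b ∈ M with a ≠ b. If the interval [a,b] is additive, then [a,b] is an arc with endpoints a and b: there is a homeomorphism from the unit interval [0,1] ⊆ ℝ onto [a,b] (with its subspace topology) sending 0 to a and 1 to b. -/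
open Set Topology

theorem Dense.denselyOrdered_subtype {α : Type*} [LinearOrder α] [TopologicalSpace α]
    [OrderTopology α] [DenselyOrdered α] {s : Set α} (hs : Dense s) : DenselyOrdered s where
  dense x y hxy := by
    obtain ⟨z, hz, h⟩ := hs.exists_between (show (x : α) < y from hxy)
    exact ⟨⟨z, hz⟩, h⟩

theorem Dense.noMinOrder_subtype {α : Type*} [LinearOrder α] [TopologicalSpace α]
    [OrderTopology α] [DenselyOrdered α] {s : Set α} (hs : Dense s)
    (hbot : ∀ x, IsBot x → x ∉ s) : NoMinOrder s where
  exists_lt x := by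
    have hx : ¬ IsBot (x : α) := fun h => hbot x h x.2
    obtain ⟨y, hy⟩ : ∃ y, y < (x : α) := by simpa [IsBot] using hx
    obtain ⟨z, hz, h⟩ := hs.exists_between hy
    exact ⟨⟨z, hz⟩, h.2⟩

theorem Dense.noMaxOrder_subtype {α : Type*} [LinearOrder α] [TopologicalSpace α]
    [OrderTopology α] [DenselyOrdered α] {s : Set α} (hs : Dense s)
    (htop : ∀ x, IsTop x → x ∉ s) : NoMaxOrder s where
  exists_gt x := by
    have hx : ¬ IsTop (x : α) := fun h => htop x h x.2
    obtain ⟨y, hy⟩ : ∃ y, (x : α) < y := by simpa [IsTop] using hx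
    obtain ⟨z, hz, h⟩ := hs.exists_between hy
    exact ⟨⟨z, hz⟩, h.1⟩

/-- Two nontrivial separable densely ordered spaces have order-isomorphic dense subsets. -/
theorem exists_dense_orderIso (α β : Type*)
    [LinearOrder α] [TopologicalSpace α] [OrderTopology α] [DenselyOrdered α]
    [TopologicalSpace.SeparableSpace α] [Nontrivial α]
    [LinearOrder β] [TopologicalSpace β] [OrderTopology β] [DenselyOrdered β]
    [TopologicalSpace.SeparableSpace β] [Nontrivial β] :
    ∃ (s : Set α) (t : Set β), Dense s ∧ Dense t ∧ Nonempty (s ≃o t) := by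
  obtain ⟨s, hsc, hs, hsb, hst⟩ := exists_countable_dense_no_bot_top α
  obtain ⟨t, htc, ht, htb, htt⟩ := exists_countable_dense_no_bot_top β
  have := hsc.to_subtype
  have := htc.to_subtype
  have := hs.denselyOrdered_subtype
  have := ht.denselyOrdered_subtype
  have := hs.noMinOrder_subtype hsb
  have := ht.noMinOrder_subtype htb
  have := hs.noMaxOrder_subtype hst
  have := ht.noMaxOrder_subtype htt
  have := hs.nonempty.to_subtype
  have := ht.nonempty.to_subtype
  exact ⟨s, t, hs, ht, Order.iso_of_countable_dense s t⟩

/-- An order isomorphism between dense subsets extends to a strictly monotone map into a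
complete linear order. -/
theorem OrderIso.exists_strictMono_extension {α β : Type*}
    [LinearOrder α] [TopologicalSpace α] [OrderTopology α] [DenselyOrdered α]
    [CompleteLinearOrder β] {s : Set α} {t : Set β} (hs : Dense s) (e : s ≃o t) :
    ∃ f : α → β, StrictMono f ∧ ∀ x : s, f x = e x := by
  let f : α → β := fun x => ⨆ q : {q : s // (q : α) ≤ x}, (e q.1 : β)
  have hle : ∀ (x : α) (q : s), (q : α) ≤ x → (e q : β) ≤ f x := fun x q hq =>
    le_iSup (fun q : {q : s // (q : α) ≤ x} => (e q.1 : β)) ⟨q, hq⟩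
  have hge : ∀ (x : α) (q : s), x ≤ q → f x ≤ e q := fun x q hq =>
    iSup_le fun r => e.monotone (show r.1 ≤ q from r.2.trans hq)
  refine ⟨f, fun x y hxy => ?_, fun x => le_antisymm (hge _ _ le_rfl) (hle _ _ le_rfl)⟩
  obtain ⟨p, hp, hxp, hpy⟩ := hs.exists_between hxy
  obtain ⟨q, hq, hpq, hqy⟩ := hs.exists_between hpy
  calc f x ≤ e ⟨p, hp⟩ := hge _ _ hxp.le
    _ < e ⟨q, hq⟩ := e.strictMono (show (⟨p, hp⟩ : s) < ⟨q, hq⟩ from hpq)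
    _ ≤ f y := hle _ _ hqy.le

/-- In a compact space whose order is closed, the topology is the order topology. -/
theorem OrderClosedTopology.orderTopology_of_compactSpace {α : Type*} [LinearOrder α]
    [t : TopologicalSpace α] [OrderClosedTopology α] [CompactSpace α] : OrderTopology α := by
  refine ⟨?_⟩
  have hle : t ≤ Preorder.topology α := by
    refine le_generateFrom ?_
    rintro u ⟨a, rfl | rfl⟩
    exacts [isOpen_Ioi, isOpen_Iio]
  have ht2 : @T2Space α (Preorder.topology α) :=
    letI := Preorder.topology α
    haveI : OrderTopology α := ⟨rfl⟩
    inferInstance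
  have hcont : @Continuous α α t (Preorder.topology α) id := continuous_id_iff_le.2 hle
  have hclosed := @Continuous.isClosedMap α α t (Preorder.topology α) _ ht2 _ hcont
  refine le_antisymm hle fun u hu => ?_
  have := hclosed uᶜ (@IsOpen.isClosed_compl α t u hu)
  rw [image_id] at this
  exact (@isClosed_compl_iff α (Preorder.topology α) u).1 this

/-- A nontrivial, separable, compact, connected linearly ordered space is an arc. -/
theorem exists_strictMono_homeomorph_unitInterval (α : Type*) [LinearOrder α]
    [TopologicalSpace α] [OrderClosedTopology α] [CompactSpace α] [PreconnectedSpace α]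
    [TopologicalSpace.SeparableSpace α] [Nontrivial α] :
    ∃ f : α ≃ₜ unitInterval, StrictMono f := by
  have : OrderTopology α := OrderClosedTopology.orderTopology_of_compactSpace
  have : DenselyOrdered α := denselyOrdered_of_preconnectedSpace
  obtain ⟨s, t, hs, ht, ⟨e⟩⟩ := exists_dense_orderIso α unitInterval
  obtain ⟨f, hf, hfe⟩ := e.exists_strictMono_extension hs
  have hdense : DenseRange f := ht.mono fun y hy =>
    ⟨e.symm ⟨y, hy⟩, by rw [hfe, e.apply_symm_apply]⟩
  have hcont : Continuous f := hf.monotone.continuous_of_denseRange hdense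
  have hsurj : Function.Surjective f := by
    rw [← range_eq_univ, ← (isCompact_range hcont).isClosed.closure_eq, hdense.closure_eq]
  have hcont' : Continuous (Equiv.ofBijective f ⟨hf.injective, hsurj⟩) := hcont
  exact ⟨hcont'.homeoOfEquivCompactToT2, hf⟩

/-- An additive interval `[a,b]` of a median algebra is linearly ordered by
`x ≤ y ↔ x ∈ [a,y]`. -/
@[reducible]
noncomputable def medIntervalLinearOrder {M : Type*} (m : M → M → M → M)
    (maj : ∀ a b : M, m a a b = a)
    (symm1 : ∀ a b c : M, m a b c = m b a c)
    (symm2 : ∀ a b c : M, m a b c = m a c b)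
    (distrib : ∀ a b c d e : M, m a b (m c d e) = m (m a b c) (m a b d) e)
    (a b : M)
    (hadd : ∀ x ∈ medInterval m a b,
      medInterval m a x ∪ medInterval m x b = medInterval m a b) :
    LinearOrder (medInterval m a b) where
  le x y := m a x y = x
  le_refl x := by rw [symm1, symm2, maj]
  le_trans x y z hxy hyz := by
    have h : m a z (m a x y) = x := by
      rw [symm2 a x y, distrib, symm2 a z y, hyz, symm2 a z a, maj, symm2, hxy]
    rwa [hxy, symm2] at h
  le_antisymm x y hxy hyx := Subtype.ext (by rw [← hxy, symm2, hyx])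
  le_total x y := by
    have hy : (y : M) ∈ medInterval m a x ∪ medInterval m x b := by
      rw [hadd x x.2]; exact y.2
    rcases hy with hy | hy
    · exact Or.inr ((symm2 _ _ _).trans hy)
    · have hx : m a b x = x := x.2
      have h : m a x (m x b y) = x := by
        rw [distrib, symm1 a x x, symm2 x a x, maj, symm2 a x b, hx, maj]
      left
      rwa [show m x b y = y from hy] at h
  toDecidableLE := Classical.decRel _

/-- In a Hausdorff path-connected topological median algebra, an additive
interval `[a,b]` (with `a ≠ b`) is an arc with endpoints `a` and `b`. -/
theorem additive_interval_is_arc {M : Type*} [TopologicalSpace M] [T2Space M]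
    [PathConnectedSpace M] (m : M → M → M → M)
    (hcont : Continuous fun p : M × M × M => m p.1 p.2.1 p.2.2)
    (maj : ∀ a b : M, m a a b = a)
    (symm1 : ∀ a b c : M, m a b c = m b a c)
    (symm2 : ∀ a b c : M, m a b c = m a c b)
    (distrib : ∀ a b c d e : M, m a b (m c d e) = m (m a b c) (m a b d) e)
    (a b : M) (hab : a ≠ b)
    (hadd : ∀ x ∈ medInterval m a b,
      medInterval m a x ∪ medInterval m x b = medInterval m a b) :
    ∃ h : unitInterval ≃ₜ (medInterval m a b),
      (h 0 : M) = a ∧ (h 1 : M) = b := by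
  let _ := medIntervalLinearOrder m maj symm1 symm2 distrib a b hadd
  have hle : ∀ x y : medInterval m a b, x ≤ y ↔ m a x y = x := fun _ _ => Iff.rfl
  have : OrderClosedTopology (medInterval m a b) := by
    refine ⟨isClosed_eq (f := fun p : medInterval m a b × medInterval m a b => m a p.1 p.2) ?_ ?_⟩
    · exact hcont.comp (f := fun p : medInterval m a b × medInterval m a b =>
        (a, (p.1 : M), (p.2 : M))) (by fun_prop)
    · fun_prop
  have ha : a ∈ medInterval m a b := by
    change m a b a = a
    rw [symm2, maj]
  have hb : b ∈ medInterval m a b := by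
    change m a b b = b
    rw [symm1, symm2, maj]
  have : Nontrivial (medInterval m a b) :=
    ⟨⟨a, ha⟩, ⟨b, hb⟩, fun h => hab (congrArg Subtype.val h)⟩
  obtain ⟨γ⟩ := PathConnectedSpace.joined a b
  have hmem : ∀ z, m a b z ∈ medInterval m a b := fun z => by
    change m a b (m a b z) = m a b z
    rw [distrib, show m a b a = a from ha, show m a b b = b from hb]
  let g : unitInterval → medInterval m a b := fun t => ⟨m a b (γ t), hmem _⟩
  have hg : Continuous g := by
    refine Continuous.subtype_mk ?_ _
    exact hcont.comp (f := fun t : unitInterval => (a, b, γ t)) (by fun_prop)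
  have hga : g 0 = ⟨a, ha⟩ := Subtype.ext ((congrArg (m a b) γ.source).trans ha)
  have hgb : g 1 = ⟨b, hb⟩ := Subtype.ext ((congrArg (m a b) γ.target).trans hb)
  have hbot : ∀ x : medInterval m a b, ⟨a, ha⟩ ≤ x := fun x => (hle _ _).2 (maj _ _)
  have htop : ∀ x : medInterval m a b, x ≤ ⟨b, hb⟩ := fun x =>
    (hle _ _).2 ((symm2 _ _ _).trans x.2)
  have hsurj : Function.Surjective g := fun x =>
    mem_range_of_exists_le_of_exists_ge hg ⟨0, hga ▸ hbot x⟩ ⟨1, hgb ▸ htop x⟩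
  have : CompactSpace (medInterval m a b) := hsurj.compactSpace hg
  have : PreconnectedSpace (medInterval m a b) := hsurj.denseRange.preconnectedSpace hg
  have : TopologicalSpace.SeparableSpace (medInterval m a b) := hsurj.denseRange.separableSpace hg
  obtain ⟨f, hf⟩ := exists_strictMono_homeomorph_unitInterval (medInterval m a b)
  refine ⟨f.symm, ?_, ?_⟩
  · suffices h : f ⟨a, ha⟩ = 0 by rw [← h, f.symm_apply_apply]
    exact le_antisymm (by simpa using hf.monotone (hbot (f.symm 0))) bot_le
  · suffices h : f ⟨b, hb⟩ = 1 by rw [← h, f.symm_apply_apply]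
    exact le_antisymm le_top (by simpa using hf.monotone (htop (f.symm 1)))
end

section
/- Let M be a Hausdorff, path-connected topological median algebra and let a,b ∈ M with a ≠ b. Then a and b are joined by an arc inside the interval [a,b]: there exists a continuous injective map γ : [0,1] → M with γ(0) = a, γ(1) = b, and γ([0,1]) ⊆ [a,b]. -/
section LinearContinuum

open Set Filter Topology TopologicalSpace

variable {T X : Type*} [LinearOrder T] [TopologicalSpace T] [OrderTopology T]

/-- A closed set containing both endpoints such that `f` takes the same value at the two ends of
every gap of the set. -/
def BridgesGaps [BoundedOrder T] (f : T → X) (K : Set T) : Prop :=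
  IsClosed K ∧ ⊥ ∈ K ∧ ⊤ ∈ K ∧ ∀ c ∈ K, ∀ d ∈ K, c < d → Disjoint (Ioo c d) K → f c = f d

theorem BridgesGaps.sInter [BoundedOrder T] [CompactSpace T] [DenselyOrdered T]
    [TopologicalSpace X] [T2Space X]
    {f : T → X} (hf : Continuous f) {C : Set (Set T)}
    (hC : ∀ K ∈ C, BridgesGaps f K) (hchain : IsChain (· ⊆ ·) C) (hne : C.Nonempty) :
    BridgesGaps f (⋂₀ C) := by
  refine ⟨isClosed_sInter fun K hK => (hC K hK).1, fun K hK => (hC K hK).2.1,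
    fun K hK => (hC K hK).2.2.1, fun c hc d hd hcd hdisj => ?_⟩
  by_contra hne'
  obtain ⟨U, V, hU, hV, hcU, hdV, hUV⟩ := t2_separation hne'
  obtain ⟨e, hce, hed⟩ := exists_between hcd
  obtain ⟨c', ⟨hcc', hc'e⟩, hc'U⟩ := (mem_nhdsGE_iff_exists_mem_Ioc_Ico_subset hce).1
    (mem_nhdsWithin_of_mem_nhds (hf.continuousAt.preimage_mem_nhds (hU.mem_nhds hcU)))
  obtain ⟨d', ⟨hed', hd'd⟩, hd'V⟩ := (mem_nhdsLE_iff_exists_mem_Ico_Ioc_subset hed).1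
    (mem_nhdsWithin_of_mem_nhds (hf.continuousAt.preimage_mem_nhds (hV.mem_nhds hdV)))
  have : Nonempty C := hne.to_subtype
  obtain ⟨⟨K, hK⟩, hKe⟩ := (isClosed_Icc (a := c') (b := d')).isCompact.elim_directed_family_closed
    (fun K : C => (K : Set T)) (fun K => (hC K K.2).1)
    (by
      rw [← sInter_eq_iInter]
      refine eq_empty_of_forall_notMem fun x hx => ?_
      exact disjoint_left.1 hdisj ⟨hcc'.trans_le hx.1.1, hx.1.2.trans_lt hd'd⟩ hx.2)
    (by
      rintro ⟨A, hA⟩ ⟨B, hB⟩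
      rcases hchain.total hA hB with h | h
      · exact ⟨⟨A, hA⟩, subset_rfl, h⟩
      · exact ⟨⟨B, hB⟩, h, subset_rfl⟩)
  have hKe' : ∀ x ∈ K, c' ≤ x → x ≤ d' → False := fun x hx h1 h2 =>
    (hKe ▸ (⟨⟨h1, h2⟩, hx⟩ : x ∈ Icc c' d' ∩ K) : x ∈ (∅ : Set T))
  obtain ⟨hKc, -, -, hKgap⟩ := hC K hK
  obtain ⟨x, ⟨hxK, hcx, hxc'⟩, hx⟩ := (hKc.inter (isClosed_Icc (a := c) (b := c'))).isCompact
    |>.exists_isGreatest ⟨c, hc K hK, le_rfl, hcc'.le⟩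
  obtain ⟨y, ⟨hyK, hd'y, hyd⟩, hy⟩ := (hKc.inter (isClosed_Icc (a := d') (b := d))).isCompact
    |>.exists_isLeast ⟨d, hd K hK, hd'd.le, le_rfl⟩
  have hc'd' : c' ≤ d' := hc'e.trans hed'
  have hxlt : x < c' := hxc'.lt_of_ne fun h => hKe' x hxK h.ge (h ▸ hc'd')
  have hylt : d' < y := hd'y.lt_of_ne fun h => hKe' y hyK (h ▸ hc'd') h.ge
  have hxy : f x = f y := by
    refine hKgap x hxK y hyK (hxlt.trans_le (hc'd'.trans hd'y)) (disjoint_left.2 ?_)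
    rintro z ⟨hxz, hzy⟩ hzK
    rcases le_total z c' with h | h
    · exact hxz.not_ge (hx ⟨hzK, hcx.trans hxz.le, h⟩)
    rcases le_total z d' with h' | h'
    · exact hKe' z hzK h h'
    · exact hzy.not_ge (hy ⟨hzK, h', hzy.le.trans hyd⟩)
  exact disjoint_left.1 hUV (hc'U ⟨hcx, hxlt⟩) (by rw [hxy]; exact hd'V ⟨hylt, hyd⟩)

theorem BridgesGaps.diff_Ioo [BoundedOrder T] {f : T → X} {K : Set T} (hK : BridgesGaps f K)
    {x y : T} (hx : x ∈ K) (hy : y ∈ K) (hfxy : f x = f y) :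
    BridgesGaps f (K \ Ioo x y) := by
  obtain ⟨hKc, hbot, htop, hgap⟩ := hK
  refine ⟨hKc.sdiff isOpen_Ioo, ⟨hbot, fun h => not_lt_bot h.1⟩, ⟨htop, fun h => not_top_lt h.2⟩, ?_⟩
  rintro c ⟨hcK, hc⟩ d ⟨hdK, hd⟩ hcd hdisj
  by_cases hcd' : Disjoint (Ioo c d) K
  · exact hgap c hcK d hdK hcd hcd'
  obtain ⟨z, hz, hzK⟩ := not_disjoint_iff.1 hcd'
  have hzxy : z ∈ Ioo x y := by
    by_contra h
    exact disjoint_left.1 hdisj hz ⟨hzK, h⟩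
  have hx' : ¬ x ∈ Ioo c d := fun h => disjoint_left.1 hdisj h ⟨hx, fun h' => h'.1.false⟩
  have hy' : ¬ y ∈ Ioo c d := fun h => disjoint_left.1 hdisj h ⟨hy, fun h' => h'.2.false⟩
  simp only [mem_Ioo, not_and, not_lt] at *
  have hcx : c = x := by
    refine le_antisymm (le_of_not_gt fun h => ?_) (le_of_not_gt fun h => ?_)
    · exact (hc h).not_gt (hz.1.trans hzxy.2)
    · exact (hx' h).not_gt (hzxy.1.trans hz.2)
  have hdy : d = y := by
    refine le_antisymm (le_of_not_gt fun h => ?_) (le_of_not_gt fun h => ?_)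
    · exact (hy' (hz.1.trans hzxy.2)).not_gt h
    · exact (hd (hzxy.1.trans hz.2)).not_gt h
  rw [hcx, hdy, hfxy]

/-- Every path in a Hausdorff space can be shortcut to a path whose fibers are order-convex. -/
theorem exists_continuous_ordConnected_fibers [BoundedOrder T] [CompactSpace T] [DenselyOrdered T]
    [TopologicalSpace X] [T2Space X]
    {f : T → X} (hf : Continuous f) :
    ∃ F : T → X, Continuous F ∧ F ⊥ = f ⊥ ∧ F ⊤ = f ⊤ ∧ (∀ t, F t ∈ range f) ∧
      ∀ s t u, s ≤ t → t ≤ u → F s = F u → F t = F s := by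
  obtain ⟨K, hK⟩ := zorn_superset {K : Set T | BridgesGaps f K} (by
    intro C hC hchain
    rcases C.eq_empty_or_nonempty with rfl | hne
    · exact ⟨univ, ⟨isClosed_univ, mem_univ _, mem_univ _, fun c _ d _ hcd h =>
        absurd (exists_between hcd) fun ⟨e, he⟩ => disjoint_left.1 h he (mem_univ e)⟩, by simp⟩
    · exact ⟨⋂₀ C, BridgesGaps.sInter hf hC hchain hne, fun K hK => sInter_subset_of_mem hK⟩)
  have hmin : ∀ x ∈ K, ∀ y ∈ K, f x = f y → Disjoint (Ioo x y) K := fun x hx y hy hxy =>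
    disjoint_left.2 fun z hz hzK =>
      (hK.2 (BridgesGaps.diff_Ioo hK.1 hx hy hxy) sdiff_subset hzK).2 hz
  obtain ⟨hKc, hbot, htop, hgap⟩ := hK.1
  choose p hp using fun t => (hKc.inter (isClosed_Iic (a := t))).isCompact.exists_isGreatest
    ⟨⊥, hbot, bot_le⟩
  choose q hq using fun t => (hKc.inter (isClosed_Ici (a := t))).isCompact.exists_isLeast
    ⟨⊤, htop, le_top⟩
  have hp_self : ∀ t ∈ K, p t = t := fun t ht =>
    le_antisymm (hp t).1.2 ((hp t).2 ⟨ht, le_rfl⟩)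
  have hq_self : ∀ t ∈ K, q t = t := fun t ht =>
    le_antisymm ((hq t).2 ⟨ht, le_rfl⟩) (hq t).1.2
  have hpq : ∀ t, f (p t) = f (q t) := by
    intro t
    by_cases ht : t ∈ K
    · rw [hp_self t ht, hq_self t ht]
    have h1 : p t < t := lt_of_le_of_ne (hp t).1.2 fun h => ht (h ▸ (hp t).1.1)
    have h2 : t < q t := lt_of_le_of_ne (hq t).1.2 fun h => ht (h ▸ (hq t).1.1)
    refine hgap _ (hp t).1.1 _ (hq t).1.1 (h1.trans h2) (disjoint_left.2 ?_)
    rintro z ⟨hz1, hz2⟩ hzK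
    rcases le_total z t with h | h
    · exact hz1.not_ge ((hp t).2 ⟨hzK, h⟩)
    · exact hz2.not_ge ((hq t).2 ⟨hzK, h⟩)
  have hp_mono : Monotone p := fun s t hst => (hp t).2 ⟨(hp s).1.1, (hp s).1.2.trans hst⟩
  refine ⟨fun t => f (p t), continuous_iff_continuousAt.2 fun t => ?_, congrArg f (hp_self _ hbot),
    congrArg f (hp_self _ htop), fun t => mem_range_self _, ?_⟩
  · have hIcc : ∀ W ∈ 𝓝 t, ∀ᶠ s in 𝓝 t, uIcc t s ⊆ W :=
      tendsto_smallSets_iff.1 (tendsto_const_nhds.uIcc tendsto_id)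
    by_cases ht : t ∈ K
    · intro W hW
      simp only [hp_self t ht] at hW
      change ∀ᶠ s in 𝓝 t, f (p s) ∈ W
      filter_upwards [hIcc _ (hf.continuousAt.preimage_mem_nhds hW)] with s hs
      rcases le_total t s with h | h
      · exact hs (uIcc_of_le h ▸ ⟨(hp s).2 ⟨ht, h⟩, (hp s).1.2⟩)
      · rw [hpq]
        exact hs (uIcc_of_ge h ▸ ⟨(hq s).1.2, (hq s).2 ⟨ht, h⟩⟩)
    · refine (continuousAt_const (y := f (p t))).congr ?_
      filter_upwards [hIcc _ (hKc.isOpen_compl.mem_nhds ht)] with s hs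
      congr 1
      rcases le_total t s with h | h
      · refine le_antisymm (hp_mono h) ((hp t).2 ⟨(hp s).1.1, le_of_not_ge fun h' => ?_⟩)
        exact hs (uIcc_of_le h ▸ ⟨h', (hp s).1.2⟩) (hp s).1.1
      · refine le_antisymm ((hp s).2 ⟨(hp t).1.1, le_of_not_ge fun h' => ?_⟩) (hp_mono h)
        exact hs (uIcc_of_ge h ▸ ⟨h', (hp t).1.2⟩) (hp t).1.1
  · intro s t u hst htu hsu
    by_cases h1 : p t = p s
    · simp only [h1]
    by_cases h2 : p t = p u
    · simp only [h2, hsu]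
    · exact absurd (hp t).1.1 (disjoint_left.1 (hmin _ (hp s).1.1 _ (hp u).1.1 hsu)
        ⟨(hp_mono hst).lt_of_ne' h1, (hp_mono htu).lt_of_ne h2⟩)

theorem exists_monotone_separating [CompactSpace T] [TopologicalSpace X] [T2Space X]
    {F : T → X} (hF : Continuous F)
    (hfib : ∀ s t u, s ≤ t → t ≤ u → F s = F u → F t = F s) {q r : T} (hqr : q < r)
    (hne : F q ≠ F r) :
    ∃ g : T → ℝ, Continuous g ∧ Monotone g ∧ (∀ t, g t ∈ Icc (0 : ℝ) 1) ∧
      (∀ s t, F s = F t → g s = g t) ∧ g q < g r := by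
  have : CompactSpace (range F) := isCompact_iff_compactSpace.1 (isCompact_range hF)
  have hF' : Continuous (rangeFactorization F) := hF.rangeFactorization
  obtain ⟨u, hu0, hu1, hu⟩ := exists_continuous_zero_one_of_isClosed
    (hF'.isClosedMap _ (isClosed_Iic (a := q))) (hF'.isClosedMap _ (isClosed_Ici (a := r)))
    (by
      rw [disjoint_left]
      rintro _ ⟨s, hs, rfl⟩ ⟨t, ht, hts⟩
      have hts' : F t = F s := congrArg Subtype.val hts
      refine hne ?_
      rw [hfib s q t hs (hqr.le.trans ht) hts'.symm, hfib s r t (hs.out.trans hqr.le) ht hts'.symm])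
  let v : T → ℝ := fun t => u (rangeFactorization F t)
  have hv : Continuous v := u.continuous.comp hF'
  have hvF : ∀ s t, F s = F t → v s = v t := fun s t h => congrArg u (Subtype.ext h)
  have hcpt : ∀ t, IsCompact ((fun x => v (min x t)) '' univ) := fun t =>
    isCompact_univ.image (by fun_prop)
  have hne' : ∀ t, ((fun x => v (min x t)) '' univ).Nonempty := fun t => ⟨_, q, mem_univ _, rfl⟩
  have hle : ∀ s t, (∀ x, ∃ y, v (min x s) = v (min y t)) →
      sSup ((fun x => v (min x s)) '' univ) ≤ sSup ((fun x => v (min x t)) '' univ) := by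
    intro s t h
    refine csSup_le_csSup (hcpt t).bddAbove (hne' s) ?_
    rintro _ ⟨x, -, rfl⟩
    obtain ⟨y, hy⟩ := h x
    exact ⟨y, mem_univ _, hy.symm⟩
  have hmono : Monotone fun t => sSup ((fun x => v (min x t)) '' univ) := fun s t hst =>
    hle s t fun x => ⟨min x s, by rw [min_assoc, min_eq_left hst]⟩
  refine ⟨fun t => sSup ((fun x => v (min x t)) '' univ),
    isCompact_univ.continuous_sSup (f := fun t x => v (min x t)) (by fun_prop), hmono,
    fun t => ?_, ?_, ?_⟩
  · obtain ⟨x, -, hx⟩ := (hcpt t).sSup_mem (hne' t)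
    simp only [← hx]
    exact hu _
  · have key : ∀ s t, s ≤ t → F s = F t →
        sSup ((fun x => v (min x s)) '' univ) = sSup ((fun x => v (min x t)) '' univ) := by
      refine fun s t hst h => le_antisymm (hmono hst) (hle t s fun x => ⟨x, ?_⟩)
      rcases le_total x s with hx | hx
      · rw [min_eq_left hx, min_eq_left (hx.trans hst)]
      · rw [min_eq_right hx]
        exact hvF _ _ (hfib s _ t (le_min hx hst) (min_le_right _ _) h)
    intro s t h
    rcases le_total s t with hst | hst
    · exact key s t hst h
    · exact (key t s hst h.symm).symm
  · have h0 : sSup ((fun x => v (min x q)) '' univ) = 0 := by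
      obtain ⟨x, -, hx⟩ := (hcpt q).sSup_mem (hne' q)
      rw [← hx]
      exact hu0 ⟨_, min_le_right x q, rfl⟩
    have h1 : v r ≤ sSup ((fun x => v (min x r)) '' univ) :=
      le_csSup (hcpt r).bddAbove ⟨r, mem_univ _, by simp⟩
    have h2 : v r = 1 := hu1 ⟨r, le_rfl, rfl⟩
    simp only [h0]
    linarith

theorem exists_continuous_monotone_eq_iff [SeparableSpace T] [CompactSpace T] [DenselyOrdered T]
    [TopologicalSpace X] [T2Space X]
    {F : T → X} (hF : Continuous F)
    (hfib : ∀ s t u, s ≤ t → t ≤ u → F s = F u → F t = F s) :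
    ∃ h : T → ℝ, Continuous h ∧ Monotone h ∧ ∀ s t, h s = h t ↔ F s = F t := by
  obtain ⟨D, hDc, hD⟩ := exists_countable_dense T
  have : Countable D := hDc.to_subtype
  let ι := {x : D × D // (x.1 : T) < x.2 ∧ F x.1 ≠ F x.2}
  have : Encodable ι := Encodable.ofCountable ι
  choose g hgc hgm hg01 hgF hg using fun i : ι => exists_monotone_separating hF hfib i.2.1 i.2.2
  have hsum : ∀ t, Summable fun i : ι => (1 / 2 : ℝ) ^ Encodable.encode i * g i t := fun t =>
    Summable.of_nonneg_of_le (fun i => mul_nonneg (by positivity) (hg01 i t).1)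
      (fun i => mul_le_of_le_one_right (by positivity) (hg01 i t).2) summable_geometric_two_encode
  have hmono : Monotone fun t => ∑' i : ι, (1 / 2 : ℝ) ^ Encodable.encode i * g i t :=
    fun s t hst => (hsum s).tsum_le_tsum
      (fun i => mul_le_mul_of_nonneg_left (hgm i hst) (by positivity)) (hsum t)
  have key : ∀ s t, s ≤ t → F s ≠ F t →
      ∑' i : ι, (1 / 2 : ℝ) ^ Encodable.encode i * g i s <
        ∑' i : ι, (1 / 2 : ℝ) ^ Encodable.encode i * g i t := by
    intro s t hst hne
    have hlt : s < t := hst.lt_of_ne fun h => hne (congrArg F h)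
    obtain ⟨U, V, hU, hV, hsU, htV, hUV⟩ := t2_separation hne
    obtain ⟨s', ⟨hss', hs't⟩, hs'U⟩ := (mem_nhdsGE_iff_exists_mem_Ioc_Ico_subset hlt).1
      (mem_nhdsWithin_of_mem_nhds (hF.continuousAt.preimage_mem_nhds (hU.mem_nhds hsU)))
    obtain ⟨q, hqD, hsq, hqs'⟩ := hD.exists_between hss'
    obtain ⟨t', ⟨hqt', ht't⟩, ht'V⟩ :=
      (mem_nhdsLE_iff_exists_mem_Ico_Ioc_subset (hqs'.trans_le hs't)).1
        (mem_nhdsWithin_of_mem_nhds (hF.continuousAt.preimage_mem_nhds (hV.mem_nhds htV)))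
    obtain ⟨r, hrD, htr, hrt⟩ := hD.exists_between ht't
    let i : ι := ⟨(⟨q, hqD⟩, ⟨r, hrD⟩), hqt'.trans_lt htr, fun h =>
      disjoint_left.1 hUV (hs'U ⟨hsq.le, hqs'⟩) (h ▸ ht'V ⟨htr, hrt.le⟩)⟩
    refine Summable.tsum_lt_tsum (i := i)
      (fun i => mul_le_mul_of_nonneg_left (hgm i hst) (by positivity)) ?_ (hsum s) (hsum t)
    exact mul_lt_mul_of_pos_left ((hgm i hsq.le).trans_lt ((hg i).trans_le (hgm i hrt.le)))
      (by positivity)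
  refine ⟨_, ?_, hmono, fun s t => ⟨fun h => ?_, fun h => tsum_congr fun i => by
    rw [hgF i s t h]⟩⟩
  · refine continuous_tsum (fun i => continuous_const.mul (hgc i)) summable_geometric_two_encode
      fun i t => ?_
    rw [Real.norm_of_nonneg (mul_nonneg (by positivity) (hg01 i t).1)]
    exact mul_le_of_le_one_right (by positivity) (hg01 i t).2
  · by_contra hne
    rcases le_total s t with hst | hst
    · exact (key s t hst hne).ne h
    · exact (key t s hst (Ne.symm hne)).ne' h

/-- In a Hausdorff space, two distinct points joined by a path are joined by an arc inside the
image of that path. -/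
theorem exists_arc_in_range {X : Type*} [TopologicalSpace X] [T2Space X] {f : unitInterval → X}
    (hf : Continuous f) (hne : f 0 ≠ f 1) :
    ∃ γ : unitInterval → X, Continuous γ ∧ Function.Injective γ ∧ γ 0 = f 0 ∧ γ 1 = f 1 ∧
      ∀ t, γ t ∈ range f := by
  obtain ⟨F, hFc, hF0, hF1, hFr, hfib⟩ := exists_continuous_ordConnected_fibers hf
  obtain ⟨h, hhc, hhm, hh⟩ := exists_continuous_monotone_eq_iff hFc hfib
  change F 0 = f 0 at hF0
  change F 1 = f 1 at hF1
  have hlt : 0 < h 1 - h 0 := sub_pos.2 <| (hhm zero_le_one).lt_of_ne fun e =>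
    hne (hF0 ▸ hF1 ▸ (hh 0 1).1 e)
  let k : unitInterval → unitInterval := fun t => ⟨(h t - h 0) / (h 1 - h 0),
    div_nonneg (sub_nonneg.2 (hhm t.2.1)) hlt.le,
    (div_le_one hlt).2 (sub_le_sub_right (hhm t.2.2) _)⟩
  have hkc : Continuous k := by
    refine Continuous.subtype_mk ?_ _
    fun_prop
  have hk0 : k 0 = 0 := Subtype.ext (by simp [k])
  have hk1 : k 1 = 1 := Subtype.ext (by simp [k, hlt.ne'])
  have hk : ∀ s t, k s = k t ↔ F s = F t := by
    intro s t
    rw [← hh, Subtype.ext_iff]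
    simp only [k, div_left_inj' hlt.ne', sub_left_inj]
  have hks : Function.Surjective k := fun y => by
    obtain ⟨x, -, hx⟩ := intermediate_value_Icc (zero_le_one (α := unitInterval)) hkc.continuousOn
      (by rw [hk0, hk1]; exact ⟨y.2.1, y.2.2⟩ : y ∈ Icc (k 0) (k 1))
    exact ⟨x, hx⟩
  have hγ : ∀ t, F (Function.surjInv hks (k t)) = F t := fun t =>
    (hk _ _).1 (Function.surjInv_eq hks (k t))
  refine ⟨fun y => F (Function.surjInv hks y), ?_, ?_, ?_, ?_, fun t => hFr _⟩
  · rw [(IsQuotientMap.of_surjective_continuous hks hkc).continuous_iff]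
    exact hFc.congr fun t => (hγ t).symm
  · intro x y hxy
    have := (hk _ _).2 hxy
    rwa [Function.surjInv_eq hks, Function.surjInv_eq hks] at this
  · have := hγ 0
    rwa [hk0, hF0] at this
  · have := hγ 1
    rwa [hk1, hF1] at this

end LinearContinuum

/-- In a Hausdorff path-connected topological median algebra, any two distinct
points are joined by an arc inside their interval. -/
theorem arc_in_interval {M : Type*} [TopologicalSpace M] [T2Space M]
    [PathConnectedSpace M] (m : M → M → M → M)
    (hcont : Continuous fun p : M × M × M => m p.1 p.2.1 p.2.2)
    (maj : ∀ a b : M, m a a b = a)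
    (symm1 : ∀ a b c : M, m a b c = m b a c)
    (symm2 : ∀ a b c : M, m a b c = m a c b)
    (distrib : ∀ a b c d e : M, m a b (m c d e) = m (m a b c) (m a b d) e)
    (a b : M) (hab : a ≠ b) :
    ∃ γ : unitInterval → M,
      Continuous γ ∧ Function.Injective γ ∧
      γ 0 = a ∧ γ 1 = b ∧ ∀ t : unitInterval, γ t ∈ medInterval m a b := by
  let p := PathConnectedSpace.somePath a b
  have ha : m a b a = a := by rw [symm2, maj]
  have hb : m a b b = b := by rw [symm1, symm2, maj]
  have hproj : ∀ x, m a b (m a b x) = m a b x := fun x => by rw [distrib, ha, hb]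
  have hf : Continuous fun t : unitInterval => m a b (p t) :=
    hcont.comp (continuous_const.prodMk (continuous_const.prodMk p.continuous))
  obtain ⟨γ, hγ, hinj, h0, h1, hr⟩ := exists_arc_in_range hf (by simpa [ha, hb] using hab)
  refine ⟨γ, hγ, hinj, by simpa [ha] using h0, by simpa [hb] using h1, fun t => ?_⟩
  obtain ⟨s, hs⟩ := hr t
  rw [← hs]
  exact hproj _
end

section
/- Let M be a Hausdorff, metrizable, path-connected, locally compact topological median algebra in which every interval [a,b] is compact. Let a,b ∈ M and let U be an open set with [a,b] ⊆ U and with compact closure. Then there exist open neighborhoods U_a of a and U_b of b such that for all x ∈ U_a and y ∈ U_b, the interval [x,y] is contained in U. -/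
theorem medInterval_eq_range {M : Type*} (m : M → M → M → M)
    (maj : ∀ a b : M, m a a b = a)
    (symm1 : ∀ a b c : M, m a b c = m b a c)
    (symm2 : ∀ a b c : M, m a b c = m a c b)
    (distrib : ∀ a b c d e : M, m a b (m c d e) = m (m a b c) (m a b d) e)
    (x y : M) : medInterval m x y = Set.range (m x y) := by
  ext z
  refine ⟨fun hz => ⟨z, hz⟩, ?_⟩
  rintro ⟨w, rfl⟩
  have hx : m x y x = x := by rw [symm2, maj]
  have hy : m x y y = y := by rw [symm1, symm2, maj]
  change m x y (m x y w) = m x y w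
  rw [distrib, hx, hy]

/-- In an interval-compact, Hausdorff, metrizable, path-connected, locally
compact topological median algebra: if `U` is open with compact closure and
`[a,b] ⊆ U`, there are neighborhoods `U_a ∋ a` and `U_b ∋ b` such that
`[x,y] ⊆ U` for all `x ∈ U_a`, `y ∈ U_b`. -/
theorem intervals_vary_continuously {M : Type*} [TopologicalSpace M] [T2Space M]
    [TopologicalSpace.MetrizableSpace M] [PathConnectedSpace M]
    [LocallyCompactSpace M] (m : M → M → M → M)
    (hcont : Continuous fun p : M × M × M => m p.1 p.2.1 p.2.2)
    (maj : ∀ a b : M, m a a b = a)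
    (symm1 : ∀ a b c : M, m a b c = m b a c)
    (symm2 : ∀ a b c : M, m a b c = m a c b)
    (distrib : ∀ a b c d e : M, m a b (m c d e) = m (m a b c) (m a b d) e)
    (hic : ∀ a b : M, IsCompact (medInterval m a b))
    (a b : M) (U : Set M) (hU : IsOpen U) (hsub : medInterval m a b ⊆ U)
    (hcl : IsCompact (closure U)) :
    ∃ Ua Ub : Set M, IsOpen Ua ∧ IsOpen Ub ∧ a ∈ Ua ∧ b ∈ Ub ∧
      ∀ x ∈ Ua, ∀ y ∈ Ub, medInterval m x y ⊆ U := by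
  have hconn (x y : M) : IsPreconnected (medInterval m x y) := by
    rw [medInterval_eq_range m maj symm1 symm2 distrib]
    exact isPreconnected_range
      (hcont.comp (continuous_const.prodMk (continuous_const.prodMk continuous_id)))
  have hleft (x y : M) : x ∈ medInterval m x y := (symm2 x y x).trans (maj x y)
  have hK : IsCompact (frontier U) :=
    hcl.of_isClosed_subset isClosed_frontier frontier_subset_closure
  have hopen : IsOpen {p : (M × M) × M | m p.1.1 p.1.2 p.2 ≠ p.2} :=
    isOpen_ne_fun (hcont.comp (by fun_prop :
      Continuous fun p : (M × M) × M => (p.1.1, p.1.2, p.2))) continuous_snd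
  obtain ⟨W, V, hW, -, habW, hKV, hWV⟩ :=
    generalized_tube_lemma (isCompact_singleton (x := (a, b))) hK hopen (by
      rintro ⟨⟨x, y⟩, z⟩ ⟨hxy, hz⟩ h
      obtain ⟨rfl, rfl⟩ := Prod.mk.inj hxy
      exact (hU.frontier_eq ▸ hz).2 (hsub h))
  obtain ⟨Ua, Ub, hUa, hUb, ha, hb, hUab⟩ :=
    isOpen_prod_iff.1 hW a b (habW rfl)
  refine ⟨Ua ∩ U, Ub, hUa.inter hU, hUb, ⟨ha, hsub (hleft a b)⟩, hb, ?_⟩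
  intro x hx y hy
  have hdisj : Disjoint (medInterval m x y) (frontier U) :=
    Set.disjoint_left.2 fun z hz hzU =>
      hWV (a := ((x, y), z)) ⟨hUab ⟨hx.1, hy⟩, hKV hzU⟩ hz
  refine (hconn x y).subset_of_closure_inter_subset hU ⟨x, hleft x y, hx.2⟩ fun z hz => ?_
  by_contra hzU
  exact Set.disjoint_left.1 hdisj hz.2 (hU.frontier_eq ▸ ⟨hz.1, hzU⟩)
end

section
/- Let M be a Hausdorff, metrizable, path-connected, locally compact topological median algebra of finite rank in which every interval is compact, and let K ⊆ M be a compact subset. Then the join J(K) = ⋃_{a,b ∈ K} [a,b] is compact. -/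
open Filter Topology in
/-- In a connected, locally compact, Hausdorff, interval-compact topological median algebra,
the join of a compact set is compact; neither metrizability nor finite rank is needed. -/
theorem join_isCompact_of_preconnected {M : Type*} [TopologicalSpace M] [T2Space M]
    [PreconnectedSpace M] [LocallyCompactSpace M] (m : M → M → M → M)
    (hcont : Continuous fun p : M × M × M => m p.1 p.2.1 p.2.2)
    (maj : ∀ a b : M, m a a b = a)
    (symm1 : ∀ a b c : M, m a b c = m b a c)
    (symm2 : ∀ a b c : M, m a b c = m a c b)
    (distrib : ∀ a b c d e : M, m a b (m c d e) = m (m a b c) (m a b d) e)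
    (hic : ∀ a b : M, IsCompact (medInterval m a b))
    (K : Set M) (hK : IsCompact K) :
    IsCompact (⋃ a ∈ K, ⋃ b ∈ K, medInterval m a b) := by
  have left (x w : M) : m x w x = x := by rw [symm2, maj]
  have right (x w : M) : m x w w = w := by rw [symm1, left]
  have idem (x w c : M) : m x w (m x w c) = m x w c := by rw [distrib, left, right]
  have tendsto_m {F : Filter M} {f g h : M → M} {p q r : M} (hf : Tendsto f F (𝓝 p))
      (hg : Tendsto g F (𝓝 q)) (hh : Tendsto h F (𝓝 r)) :
      Tendsto (fun x => m (f x) (g x) (h x)) F (𝓝 (m p q r)) :=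
    (hcont.tendsto (p, q, r)).comp (hf.prodMk_nhds (hg.prodMk_nhds hh))
  -- An ultrafilter sends any function eventually valued in a compact set to a convergent one.
  have lim {F : Ultrafilter M} {S : Set M} (hS : IsCompact S) {f : M → M}
      (hf : ∀ᶠ x in (F : Filter M), f x ∈ S) : ∃ p ∈ S, Tendsto f F (𝓝 p) :=
    hS.ultrafilter_le_nhds (F.map f) (le_principal_iff.mpr hf)
  rw [isCompact_iff_ultrafilter_le_nhds]
  intro F hF
  have hJ : ∀ x ∈ ⋃ a ∈ K, ⋃ b ∈ K, medInterval m a b,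
      ∃ a b, a ∈ K ∧ b ∈ K ∧ m a b x = x := by
    intro x hx
    simp only [Set.mem_iUnion] at hx
    obtain ⟨a, ha, b, hb, hx⟩ := hx
    exact ⟨a, b, ha, hb, hx⟩
  choose! a b ha hb hab using hJ
  have hF' : ∀ᶠ x in (F : Filter M), x ∈ ⋃ a ∈ K, ⋃ b ∈ K, medInterval m a b :=
    le_principal_iff.mp hF
  obtain ⟨a₀, ha₀, hta⟩ := lim hK (hF'.mono ha)
  obtain ⟨b₀, hb₀, htb⟩ := lim hK (hF'.mono hb)
  obtain ⟨y, hy, hty⟩ := lim (F := F) (f := m a₀ b₀) (hic a₀ b₀)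
    (Eventually.of_forall fun x => idem a₀ b₀ x)
  have hy : m a₀ b₀ y = y := hy
  refine ⟨y, Set.mem_biUnion ha₀ (Set.mem_biUnion hb₀ hy), ?_⟩
  refine (compact_basis_nhds y).ge_iff.mpr fun N ⟨hN, hNc⟩ => ?_
  by_contra hxN
  have hxN : ∀ᶠ x in (F : Filter M), x ∉ N := Ultrafilter.eventually_not.mpr hxN
  let w x := m (a x) (b x) y
  have hw : Tendsto w F (𝓝 y) := by
    simpa only [hy] using tendsto_m hta htb (tendsto_const_nhds (x := y))
  have hz : ∀ x, x ∉ N → w x ∈ N → ∃ z ∈ frontier N, m x (w x) z = z := by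
    intro x hx hwx
    have hc : Continuous (m x (w x)) :=
      hcont.comp (by fun_prop : Continuous fun c => (x, w x, c))
    obtain ⟨c, hcN⟩ : (frontier (m x (w x) ⁻¹' N)).Nonempty := by
      refine nonempty_frontier_iff.mpr ⟨⟨w x, ?_⟩, (Set.ne_univ_iff_exists_notMem _).mpr ⟨x, ?_⟩⟩
      · simpa only [Set.mem_preimage, right] using hwx
      · simpa only [Set.mem_preimage, left] using hx
    exact ⟨_, hc.frontier_preimage_subset N hcN, idem _ _ _⟩
  choose! z hzN hzm using hz
  have hwN : ∀ᶠ x in (F : Filter M), w x ∈ N := hw hN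
  obtain ⟨z₀, hz₀, htz⟩ := lim (f := z)
    (hNc.of_isClosed_subset isClosed_frontier hNc.isClosed.frontier_subset)
    ((hxN.and hwN).mono fun x h => hzN x h.1 h.2)
  have hz_mem : m a₀ b₀ z₀ = z₀ := by
    refine tendsto_nhds_unique_of_eventuallyEq (tendsto_m hta htb htz) htz ?_
    filter_upwards [hF', hxN, hwN] with x hx hxN hwN
    rw [← hzm x hxN hwN, distrib, hab x hx, idem]
  have hz_proj : m a₀ b₀ z₀ = y := by
    have h := tendsto_m hty (tendsto_m (tendsto_const_nhds (x := a₀))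
      (tendsto_const_nhds (x := b₀)) hw) htz
    rw [hy, maj] at h
    refine tendsto_nhds_unique_of_eventuallyEq
      (tendsto_m tendsto_const_nhds tendsto_const_nhds htz) h ?_
    filter_upwards [hxN, hwN] with x hxN hwN
    nth_rw 1 [← hzm x hxN hwN]
    rw [distrib]
  have hzy : z₀ = y := hz_mem.symm.trans hz_proj
  exact hz₀.2 (hzy ▸ mem_interior_iff_mem_nhds.mpr hN)

/-- In a Hausdorff, metrizable, path-connected, locally compact,
interval-compact topological median algebra of finite rank, the join
`J(K) = ⋃_{a,b ∈ K} [a,b]` of a compact set `K` is compact. -/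
theorem join_of_compact_is_compact {M : Type*} [TopologicalSpace M] [T2Space M]
    [TopologicalSpace.MetrizableSpace M] [PathConnectedSpace M]
    [LocallyCompactSpace M] (m : M → M → M → M)
    (hcont : Continuous fun p : M × M × M => m p.1 p.2.1 p.2.2)
    (maj : ∀ a b : M, m a a b = a)
    (symm1 : ∀ a b c : M, m a b c = m b a c)
    (symm2 : ∀ a b c : M, m a b c = m a c b)
    (distrib : ∀ a b c d e : M, m a b (m c d e) = m (m a b c) (m a b d) e)
    (hrank : ∃ n : ℕ, ∀ k : ℕ, ∀ f : (Fin k → Bool) → M,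
      Function.Injective f →
      (∀ u v w : Fin k → Bool,
        f (fun i => bmed (u i) (v i) (w i)) = m (f u) (f v) (f w)) →
      k ≤ n)
    (hic : ∀ a b : M, IsCompact (medInterval m a b))
    (K : Set M) (hK : IsCompact K) :
    IsCompact (⋃ a ∈ K, ⋃ b ∈ K, medInterval m a b) :=
  join_isCompact_of_preconnected m hcont maj symm1 symm2 distrib hic K hK
end
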